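/- Suppose d ≥ 2 is even and let Φ ∈ 𝒮(ℂ^d). Then there is a unique function f : ℂ∖{0} → ℂ, smooth as a function of the two real coordinates, such that ∫_{ℂ^d} g(q_d(z)) Φ(z) dz = ∫_ℂ g(ξ) f(ξ) dξ for every continuous compactly supported g : ℂ → ℂ whose support does not contain 0. Moreover there exist functions C₀, C₁ : ℂ → ℂ, smooth as functions of the two real coordinates, such that f(ξ) = C₀(ξ) + C₁(ξ)·|ξ|^{d−2}·log|ξ| for all ξ ≠ 0. -/

import Mathlib

open MeasureTheory Filter

noncomputable section

/-- Extension of a vector in `ℂ^d` by zeros, for convenient indexing. -/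
def padC {d : ℕ} (z : Fin d → ℂ) (n : ℕ) : ℂ :=
  if h : n < d then z ⟨n, h⟩ else 0

/-- The split quadratic form `q_d` on `ℂ^d`. -/
def splitQC (d : ℕ) (z : Fin d → ℂ) : ℂ :=
  if Even d then ∑ i ∈ Finset.range (d / 2), padC z (2 * i) * padC z (2 * i + 1)
  else padC z 0 ^ 2 + ∑ i ∈ Finset.range (d / 2), padC z (2 * i + 1) * padC z (2 * i + 2)

section CoreFourier
open scoped FourierTransform RealInnerProductSpace

variable {E : Type*} [NormedAddCommGroup E] [InnerProductSpace ℝ E] [FiniteDimensional ℝ E]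
  [MeasurableSpace E] [BorelSpace E]

lemma gp_schwartz_bound (G : SchwartzMap (WithLp 2 (E × E)) ℂ) (k : ℕ) :
    ∃ C : ℝ, 0 ≤ C ∧ ∀ x y : E, ‖G (WithLp.toLp 2 (x, y))‖ ≤
      C * ((1 + ‖x‖) ^ (-(k : ℝ)) * (1 + ‖y‖) ^ (-(k : ℝ))) := by
  have h := fun z => SchwartzMap.one_add_le_sup_seminorm_apply (𝕜 := ℝ) (m := (2 * k, 0))
    (le_refl (2 * k)) (le_refl 0) G z
  set C := 2 ^ (2 * k) * ((Finset.Iic (2 * k, 0)).sup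
    fun m => SchwartzMap.seminorm ℝ m.1 m.2) G with hC
  refine ⟨C, ?_, fun x y => ?_⟩
  · refine le_trans ?_ (h 0)
    positivity
  · have h1 := h (WithLp.toLp 2 (x, y))
    rw [norm_iteratedFDeriv_zero] at h1
    have hx : ‖x‖ ≤ ‖(WithLp.toLp 2 (x, y) : WithLp 2 (E × E))‖ := by
      rw [WithLp.prod_norm_eq_of_L2]
      apply Real.le_sqrt_of_sq_le
      simp
    have hy : ‖y‖ ≤ ‖(WithLp.toLp 2 (x, y) : WithLp 2 (E × E))‖ := by
      rw [WithLp.prod_norm_eq_of_L2]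
      apply Real.le_sqrt_of_sq_le
      simp
    have px : 0 < 1 + ‖x‖ := by positivity
    have py : 0 < 1 + ‖y‖ := by positivity
    rw [Real.rpow_neg px.le, Real.rpow_neg py.le, Real.rpow_natCast, Real.rpow_natCast,
      ← mul_inv, ← div_eq_mul_inv, le_div_iff₀ (by positivity)]
    refine le_trans ?_ h1
    rw [mul_comm, two_mul, pow_add]
    gcongr

lemma gp_int_one_add : Integrable (fun x : E => (1 + ‖x‖) ^ (-((Module.finrank ℝ E + 1 : ℕ) : ℝ))) := by
  apply integrable_one_add_norm
  push_cast
  linarith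

lemma gp_slice_left (G : SchwartzMap (WithLp 2 (E × E)) ℂ) (y : E) :
    Integrable (fun x : E => G (WithLp.toLp 2 (x, y))) := by
  obtain ⟨C, hC, h⟩ := gp_schwartz_bound G (Module.finrank ℝ E + 1)
  refine Integrable.mono' ((gp_int_one_add (E := E)).mul_const ((1 + ‖y‖) ^ (-((Module.finrank ℝ E + 1 : ℕ) : ℝ)))
    |>.const_mul C) ?_ (Eventually.of_forall fun x => h x y)
  apply Continuous.aestronglyMeasurable
  fun_prop

lemma gp_slice_right (G : SchwartzMap (WithLp 2 (E × E)) ℂ) (x : E) :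
    Integrable (fun y : E => G (WithLp.toLp 2 (x, y))) := by
  obtain ⟨C, hC, h⟩ := gp_schwartz_bound G (Module.finrank ℝ E + 1)
  refine Integrable.mono' ((gp_int_one_add (E := E)).const_mul ((1 + ‖x‖) ^ (-((Module.finrank ℝ E + 1 : ℕ) : ℝ)))
    |>.const_mul C) ?_ (Eventually.of_forall fun y => h x y)
  apply Continuous.aestronglyMeasurable
  fun_prop

lemma gp_prod_int (G : SchwartzMap (WithLp 2 (E × E)) ℂ) :
    Integrable (fun p : E × E => G (WithLp.toLp 2 p)) :=
  ((WithLp.volume_preserving_toLp E E).integrable_comp_emb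
    (MeasurableEquiv.toLp 2 (E × E)).measurableEmbedding).2 G.integrable

/-- partial Fourier inverse -/
def gpPsi (H : SchwartzMap (WithLp 2 (E × E)) ℂ) (y u : E) : ℂ :=
  ∫ ζ : E, 𝐞 (⟪ζ, y⟫) • H (WithLp.toLp 2 (u, ζ))

lemma gp_psi_bound (H : SchwartzMap (WithLp 2 (E × E)) ℂ) : ∃ C : ℝ, ∀ y u,
    ‖gpPsi H y u‖ ≤ C * (1 + ‖u‖) ^ (-((Module.finrank ℝ E + 1 : ℕ) : ℝ)) := by
  obtain ⟨C, hC, h⟩ := gp_schwartz_bound H (Module.finrank ℝ E + 1)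
  refine ⟨C * ∫ ζ : E, (1 + ‖ζ‖) ^ (-((Module.finrank ℝ E + 1 : ℕ) : ℝ)), fun y u => ?_⟩
  have : C * (∫ ζ : E, (1 + ‖ζ‖) ^ (-((Module.finrank ℝ E + 1 : ℕ) : ℝ))) *
      (1 + ‖u‖) ^ (-((Module.finrank ℝ E + 1 : ℕ) : ℝ)) =
      ∫ ζ : E, C * ((1 + ‖u‖) ^ (-((Module.finrank ℝ E + 1 : ℕ) : ℝ)) *
        (1 + ‖ζ‖) ^ (-((Module.finrank ℝ E + 1 : ℕ) : ℝ))) := by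
    rw [integral_const_mul, integral_const_mul]; ring
  rw [this]
  refine norm_integral_le_of_norm_le
    (((gp_int_one_add (E := E)).const_mul _).const_mul _) (Eventually.of_forall fun ζ => ?_)
  rw [Circle.norm_smul]
  exact h u ζ

lemma gp_psi_cont (H : SchwartzMap (WithLp 2 (E × E)) ℂ) :
    Continuous (fun p : E × E => gpPsi H p.1 p.2) := by
  obtain ⟨C, hC, h⟩ := gp_schwartz_bound H (Module.finrank ℝ E + 1)
  refine continuous_of_dominated (F := fun (p : E × E) (ζ : E) =>
      𝐞 (⟪ζ, p.1⟫) • H (WithLp.toLp 2 (p.2, ζ)))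
    (bound := fun ζ => C * (1 + ‖ζ‖) ^ (-((Module.finrank ℝ E + 1 : ℕ) : ℝ))) ?_ ?_ ?_ ?_
  · intro p
    apply Continuous.aestronglyMeasurable
    simp only [Circle.smul_def]
    fun_prop
  · intro p
    refine Eventually.of_forall fun ζ => ?_
    rw [Circle.norm_smul]
    refine (h p.2 ζ).trans ?_
    gcongr
    refine mul_le_of_le_one_left (by positivity) ?_
    apply Real.rpow_le_one_of_one_le_of_nonpos
    · linarith [norm_nonneg p.2]
    · rw [neg_nonpos]; positivity
  · exact (gp_int_one_add (E := E)).const_mul _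
  · refine Eventually.of_forall fun ζ => ?_
    simp only [Circle.smul_def]
    fun_prop

lemma gp_psi_eq (G : SchwartzMap (WithLp 2 (E × E)) ℂ) (y : E) :
    𝓕 (fun x : E => G (WithLp.toLp 2 (x, y))) = gpPsi (𝓕 G) y := by
  obtain ⟨C, h⟩ := gp_psi_bound (𝓕 G)
  have hc : Continuous (gpPsi (𝓕 G) y) := (gp_psi_cont (𝓕 G)).comp (by fun_prop : Continuous fun u : E => (y, u))
  have hi : Integrable (gpPsi (𝓕 G) y) := by
    refine Integrable.mono' ((gp_int_one_add (E := E)).const_mul C) hc.aestronglyMeasurable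
      (Eventually.of_forall fun u => h y u)
  have hinv : 𝓕⁻ (gpPsi (𝓕 G) y) = (fun x : E => G (WithLp.toLp 2 (x, y))) := by
    ext x
    have h1 : G = 𝓕⁻ (𝓕 G) := by simp
    conv_rhs => rw [h1]
    rw [SchwartzMap.fourierInv_coe, Real.fourierInv_eq, Real.fourierInv_eq]
    rw [← (WithLp.volume_preserving_toLp E E).integral_comp
      (MeasurableEquiv.toLp 2 (E × E)).measurableEmbedding]
    rw [Measure.volume_eq_prod, integral_prod]
    · congr 1
      ext u
      simp only [gpPsi]
      rw [Circle.smul_def, ← integral_smul]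
      congr 1
      ext ζ
      rw [WithLp.prod_inner_apply, AddChar.map_add_eq_mul, mul_smul]
      simp [Circle.smul_def]
    · have := gp_prod_int (𝓕 G)
      refine Integrable.mono' (this.norm) ?_ (Eventually.of_forall fun p => ?_)
      · apply Continuous.aestronglyMeasurable
        simp only [Circle.smul_def]
        fun_prop
      · rw [Circle.norm_smul]
  rw [← hinv]
  apply Continuous.fourier_fourierInv_eq hc hi
  have : 𝓕 (gpPsi (𝓕 G) y) = fun v => 𝓕⁻ (gpPsi (𝓕 G) y) (-v) := by
    ext v
    rw [Real.fourierInv_eq_fourier_neg, neg_neg]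
  rw [this, hinv]
  exact (gp_slice_left G y).comp_neg

theorem gp_core (G : SchwartzMap (WithLp 2 (E × E)) ℂ) (J : E ≃ₗᵢ[ℝ] E) (r : ℝ) (hr : 0 < r) :
    ∫ y : E, ∫ x : E, 𝐞 (-⟪x, r • J y⟫) • G (WithLp.toLp 2 (x, y)) =
      (((r ^ Module.finrank ℝ E)⁻¹ : ℝ) : ℂ) *
        ∫ u : E, ∫ ζ : E, 𝐞 (⟪ζ, r⁻¹ • J.symm u⟫) • (𝓕 G) (WithLp.toLp 2 (u, ζ)) := by
  have h1 : ∀ y : E, ∫ x : E, 𝐞 (-⟪x, r • J y⟫) • G (WithLp.toLp 2 (x, y)) =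
      gpPsi (𝓕 G) (r⁻¹ • J.symm (r • J y)) (r • J y) := by
    intro y
    rw [← Real.fourier_eq (fun x : E => G (WithLp.toLp 2 (x, y))) (r • J y), gp_psi_eq]
    congr 1
    simp [hr.ne']
  simp_rw [h1]
  have h2 := J.measurePreserving.integral_comp J.toHomeomorph.measurableEmbedding
    (fun w => gpPsi (𝓕 G) (r⁻¹ • J.symm (r • w)) (r • w))
  rw [h2]
  rw [Measure.integral_comp_smul volume (fun w => gpPsi (𝓕 G) (r⁻¹ • J.symm w) w) r]
  rw [abs_of_pos (by positivity), Complex.real_smul]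
  rfl
end CoreFourier

section CoreExpand
open scoped FourierTransform RealInnerProductSpace

lemma gp_exp_bound (N : ℕ) (x : ℝ) :
    ‖Complex.exp (x * Complex.I) - ∑ n ∈ Finset.range N, (x * Complex.I) ^ n / (n.factorial : ℂ)‖ ≤
      (1 + Real.exp 1) * |x| ^ N := by
  rcases le_or_gt |x| 1 with h | h
  · have h1 := Complex.norm_exp_sub_sum_le_norm_mul_exp (x * Complex.I) N
    have h2 : ‖(x : ℂ) * Complex.I‖ = |x| := by simp
    rw [h2] at h1
    refine h1.trans ?_
    rw [mul_comm]
    gcongr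
    have := Real.exp_le_exp.2 h
    linarith
  · refine (norm_sub_le _ _).trans ?_
    rw [Complex.norm_exp_ofReal_mul_I, add_mul, one_mul]
    have h3 : (1 : ℝ) ≤ |x| ^ N := one_le_pow₀ h.le
    refine add_le_add h3 ?_
    refine (norm_sum_le _ _).trans ?_
    have h4 : ∀ n ∈ Finset.range N, ‖((x : ℂ) * Complex.I) ^ n / (n.factorial : ℂ)‖ ≤
        |x| ^ N * (1 ^ n / n.factorial) := by
      intro n hn
      rw [norm_div, norm_pow, norm_mul, Complex.norm_I, mul_one, Complex.norm_real,
        Complex.norm_natCast, Real.norm_eq_abs, one_pow, mul_one_div]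
      gcongr
      · exact h.le
      · exact (Finset.mem_range.1 hn).le
    refine (Finset.sum_le_sum h4).trans ?_
    rw [← Finset.mul_sum, mul_comm]
    gcongr
    exact Real.sum_le_exp_of_nonneg zero_le_one N

/-- the bilinear form -/
def gpQ {m : ℕ} (x y : EuclideanSpace ℂ (Fin m)) : ℂ := ∑ i, x i * y i

lemma gpQ_cont {m : ℕ} : Continuous (fun p : EuclideanSpace ℂ (Fin m) × EuclideanSpace ℂ (Fin m) =>
    gpQ p.1 p.2) := by
  unfold gpQ
  fun_prop

lemma gpQ_norm {m : ℕ} (x y : EuclideanSpace ℂ (Fin m)) :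
    ‖gpQ x y‖ ≤ m * ‖(WithLp.toLp 2 (y, x) :
      WithLp 2 (EuclideanSpace ℂ (Fin m) × EuclideanSpace ℂ (Fin m)))‖ ^ 2 := by
  unfold gpQ
  refine (norm_sum_le _ _).trans ?_
  have : ∀ i ∈ (Finset.univ : Finset (Fin m)), ‖x i * y i‖ ≤ ‖(WithLp.toLp 2 (y, x) :
      WithLp 2 (EuclideanSpace ℂ (Fin m) × EuclideanSpace ℂ (Fin m)))‖ ^ 2 := by
    intro i _
    rw [norm_mul, WithLp.prod_norm_sq_eq_of_L2]
    have h1 := PiLp.norm_apply_le x i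
    have h2 := PiLp.norm_apply_le y i
    change ‖x i‖ * ‖y i‖ ≤ ‖y‖ ^ 2 + ‖x‖ ^ 2
    nlinarith [mul_le_mul h1 h2 (norm_nonneg _) (norm_nonneg _), norm_nonneg (x i), norm_nonneg (y i), sq_nonneg (‖x‖ - ‖y‖), norm_nonneg x,
      norm_nonneg y]
  refine (Finset.sum_le_sum this).trans ?_
  simp

/-- The isometry -/
def gpJ (m : ℕ) (t : ℂ) : EuclideanSpace ℂ (Fin m) ≃ₗᵢ[ℝ] EuclideanSpace ℂ (Fin m) :=
  LinearIsometryEquiv.piLpCongrRight 2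
    (fun _ => Complex.conjLIE.trans (rotation (Circle.exp t.arg)))

lemma gp_A0_formula {m : ℕ} (G : SchwartzMap (WithLp 2 (EuclideanSpace ℂ (Fin m) × EuclideanSpace ℂ (Fin m))) ℂ)
    (t : ℂ) (ht : t ≠ 0) :
    ∫ y : EuclideanSpace ℂ (Fin m), ∫ x : EuclideanSpace ℂ (Fin m),
        𝐞 (-⟪gpQ x y, t⟫) • G (WithLp.toLp 2 (x, y)) =
      (((‖t‖ ^ (2 * m))⁻¹ : ℝ) : ℂ) *
        ∫ u : EuclideanSpace ℂ (Fin m), ∫ ζ : EuclideanSpace ℂ (Fin m),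
          𝐞 ((gpQ ζ u * t⁻¹).re) • (𝓕 G) (WithLp.toLp 2 (u, ζ)) := by
  have h := gp_core G (gpJ m t) ‖t‖ (norm_pos_iff.2 ht)
  have hfr : Module.finrank ℝ (EuclideanSpace ℂ (Fin m)) = 2 * m := by
    rw [(WithLp.linearEquiv 2 ℝ (Fin m → ℂ)).finrank_eq, Module.finrank_pi_fintype]
    simp [Complex.finrank_real_complex, mul_comm]
  have hexp : (‖t‖ : ℂ) * Complex.exp (t.arg * Complex.I) = t := Complex.norm_mul_exp_arg_mul_I t
  have h1 : ∀ x y : EuclideanSpace ℂ (Fin m), ⟪x, ‖t‖ • gpJ m t y⟫ = ⟪gpQ x y, t⟫ := by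
    intro x y
    rw [PiLp.inner_apply, gpQ, sum_inner]
    refine Finset.sum_congr rfl fun i _ => ?_
    have : (‖t‖ • gpJ m t y) i = t * (starRingEnd ℂ) (y i) := by
      simp [gpJ, rotation_apply, Circle.coe_exp]
      rw [← mul_assoc, hexp]
    rw [this, Complex.inner, Complex.inner]
    simp
    ring
  have h2 : ∀ ζ u : EuclideanSpace ℂ (Fin m), ⟪ζ, ‖t‖⁻¹ • (gpJ m t).symm u⟫ = (gpQ ζ u * t⁻¹).re := by
    intro x y
    rw [PiLp.inner_apply, gpQ, Finset.sum_mul, Complex.re_sum]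
    refine Finset.sum_congr rfl fun i _ => ?_
    have : (‖t‖⁻¹ • (gpJ m t).symm y) i = (starRingEnd ℂ) (t⁻¹ * (y i)) := by
      have h0 : (gpJ m t).symm y = (WithLp.toLp 2 fun i =>
          (starRingEnd ℂ) (Complex.exp (-t.arg * Complex.I) * y i)) := by
        rw [LinearIsometryEquiv.symm_apply_eq]
        ext j
        simp [gpJ, rotation_apply, Circle.coe_exp]
        rw [← mul_assoc, ← Complex.exp_add]
        simp
      rw [h0]
      conv_rhs => rw [← hexp]
      rw [mul_inv, ← Complex.exp_neg, map_mul, map_mul, map_inv₀, Complex.conj_ofReal]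
      simp
      ring
    rw [this, Complex.inner, ← map_mul, Complex.conj_re]
    congr 1
    ring
  simp_rw [h1, h2, hfr] at h
  exact h

theorem gp_A0_expand {m : ℕ} (G : SchwartzMap (WithLp 2 (EuclideanSpace ℂ (Fin m) × EuclideanSpace ℂ (Fin m))) ℂ) :
    ∃ a : ℕ → ℕ → ℂ, ∀ N : ℕ, ∃ C : ℝ, ∀ t : ℂ, t ≠ 0 →
    ‖(∫ y : EuclideanSpace ℂ (Fin m), ∫ x : EuclideanSpace ℂ (Fin m),
        𝐞 (-⟪gpQ x y, t⟫) • G (WithLp.toLp 2 (x, y))) -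
      ∑ n ∈ Finset.range N, ∑ pq ∈ Finset.HasAntidiagonal.antidiagonal n,
        a pq.1 pq.2 * (t⁻¹ ^ (pq.1 + m) * (starRingEnd ℂ t⁻¹) ^ (pq.2 + m))‖ ≤
      C * ‖t‖⁻¹ ^ (N + 2 * m) := by
  set H := 𝓕 G with hH
  have hint : ∀ k : ℕ, Integrable (fun z : EuclideanSpace ℂ (Fin m) × EuclideanSpace ℂ (Fin m) =>
      ‖gpQ z.2 z.1‖ ^ k * ‖H (WithLp.toLp 2 z)‖) := by
    intro k
    have h0 := ((WithLp.volume_preserving_toLp (EuclideanSpace ℂ (Fin m)) (EuclideanSpace ℂ (Fin m))).integrable_comp_emb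
      (MeasurableEquiv.toLp 2 _).measurableEmbedding).2 (H.integrable_pow_mul volume (2 * k))
    refine Integrable.mono' (h0.const_mul ((m : ℝ) ^ k)) ?_ (Eventually.of_forall fun z => ?_)
    · apply Continuous.aestronglyMeasurable
      have := (gpQ_cont (m := m)).comp continuous_swap
      have h3 : Continuous (fun z : EuclideanSpace ℂ (Fin m) × EuclideanSpace ℂ (Fin m) => gpQ z.2 z.1) := this
      fun_prop
    · have := gpQ_norm z.2 z.1
      simp only [Function.comp, norm_mul, norm_pow, norm_norm]
      rw [← mul_assoc, pow_mul, ← mul_pow]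
      gcongr
  have hcQ : Continuous (fun z : EuclideanSpace ℂ (Fin m) × EuclideanSpace ℂ (Fin m) => gpQ z.2 z.1) :=
    (gpQ_cont (m := m)).comp continuous_swap
  have hintC : ∀ p q : ℕ, Integrable (fun z : EuclideanSpace ℂ (Fin m) × EuclideanSpace ℂ (Fin m) =>
      gpQ z.2 z.1 ^ p * (starRingEnd ℂ (gpQ z.2 z.1)) ^ q * H (WithLp.toLp 2 z)) := by
    intro p q
    refine Integrable.mono' (hint (p + q)) ?_ (Eventually.of_forall fun z => ?_)
    · apply Continuous.aestronglyMeasurable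
      have := Complex.continuous_conj
      fun_prop
    · simp [pow_add]
  refine ⟨fun p q => (Real.pi * Complex.I) ^ (p + q) / ((p + q).factorial : ℂ) * ((p + q).choose p : ℂ) *
    ∫ z : EuclideanSpace ℂ (Fin m) × EuclideanSpace ℂ (Fin m),
      gpQ z.2 z.1 ^ p * (starRingEnd ℂ (gpQ z.2 z.1)) ^ q * H (WithLp.toLp 2 z), fun N => ?_⟩
  refine ⟨(1 + Real.exp 1) * (2 * Real.pi) ^ N * ∫ z : EuclideanSpace ℂ (Fin m) × EuclideanSpace ℂ (Fin m),
    ‖gpQ z.2 z.1‖ ^ N * ‖H (WithLp.toLp 2 z)‖, fun t ht => ?_⟩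
  rw [gp_A0_formula G t ht, ← hH]
  have hintE : Integrable (fun z : EuclideanSpace ℂ (Fin m) × EuclideanSpace ℂ (Fin m) =>
      𝐞 ((gpQ z.2 z.1 * t⁻¹).re) • H (WithLp.toLp 2 z)) := by
    refine Integrable.mono' (gp_prod_int H).norm ?_ (Eventually.of_forall fun z => ?_)
    · apply Continuous.aestronglyMeasurable
      simp only [Circle.smul_def]
      have := Complex.continuous_re
      fun_prop
    · rw [Circle.norm_smul]
  have e1 : ∫ u : EuclideanSpace ℂ (Fin m), ∫ ζ : EuclideanSpace ℂ (Fin m),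
          𝐞 ((gpQ ζ u * t⁻¹).re) • H (WithLp.toLp 2 (u, ζ)) =
      ∫ z : EuclideanSpace ℂ (Fin m) × EuclideanSpace ℂ (Fin m),
        𝐞 ((gpQ z.2 z.1 * t⁻¹).re) • H (WithLp.toLp 2 z) := by
    rw [Measure.volume_eq_prod, integral_prod]
    exact hintE
  rw [e1]
  have hkey : ∀ n : ℕ, ∀ z : EuclideanSpace ℂ (Fin m) × EuclideanSpace ℂ (Fin m),
      (((2 * Real.pi * (gpQ z.2 z.1 * t⁻¹).re : ℝ) : ℂ) * Complex.I) ^ n / (n.factorial : ℂ) * H (WithLp.toLp 2 z) =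
      ∑ pq ∈ Finset.HasAntidiagonal.antidiagonal n, ((Real.pi * Complex.I) ^ n / (n.factorial : ℂ) * (n.choose pq.1 : ℂ) *
        (t⁻¹ ^ pq.1 * (starRingEnd ℂ t⁻¹) ^ pq.2)) *
        (gpQ z.2 z.1 ^ pq.1 * (starRingEnd ℂ (gpQ z.2 z.1)) ^ pq.2 * H (WithLp.toLp 2 z)) := by
    intro n z
    have hre : (((2 * Real.pi * (gpQ z.2 z.1 * t⁻¹).re : ℝ) : ℂ) * Complex.I) =
        (Real.pi * Complex.I) * (gpQ z.2 z.1 * t⁻¹ + starRingEnd ℂ (gpQ z.2 z.1) * starRingEnd ℂ t⁻¹) := by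
      rw [← map_mul, Complex.add_conj]
      push_cast
      ring
    rw [hre, mul_pow, (Commute.all _ _).add_pow', Finset.mul_sum, Finset.sum_div, Finset.sum_mul]
    refine Finset.sum_congr rfl fun pq _ => ?_
    rw [nsmul_eq_mul, mul_pow, mul_pow]
    ring
  have hterm : ∀ n : ℕ, Integrable (fun z : EuclideanSpace ℂ (Fin m) × EuclideanSpace ℂ (Fin m) =>
      (((2 * Real.pi * (gpQ z.2 z.1 * t⁻¹).re : ℝ) : ℂ) * Complex.I) ^ n / (n.factorial : ℂ) * H (WithLp.toLp 2 z)) := by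
    intro n
    simp_rw [hkey]
    exact integrable_finsetSum _ fun pq _ => (hintC pq.1 pq.2).const_mul _
  have e2 : ∑ n ∈ Finset.range N, ∑ pq ∈ Finset.HasAntidiagonal.antidiagonal n,
        ((Real.pi * Complex.I) ^ (pq.1 + pq.2) / ((pq.1 + pq.2).factorial : ℂ) * ((pq.1 + pq.2).choose pq.1 : ℂ) *
    ∫ z : EuclideanSpace ℂ (Fin m) × EuclideanSpace ℂ (Fin m),
      gpQ z.2 z.1 ^ pq.1 * (starRingEnd ℂ (gpQ z.2 z.1)) ^ pq.2 * H (WithLp.toLp 2 z)) *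
        (t⁻¹ ^ (pq.1 + m) * (starRingEnd ℂ t⁻¹) ^ (pq.2 + m)) =
      (((‖t‖ ^ (2 * m))⁻¹ : ℝ) : ℂ) * ∫ z : EuclideanSpace ℂ (Fin m) × EuclideanSpace ℂ (Fin m),
        ∑ n ∈ Finset.range N, (((2 * Real.pi * (gpQ z.2 z.1 * t⁻¹).re : ℝ) : ℂ) * Complex.I) ^ n / (n.factorial : ℂ) *
          H (WithLp.toLp 2 z) := by
    rw [integral_finsetSum _ fun n _ => hterm n, Finset.mul_sum]
    refine Finset.sum_congr rfl fun n _ => ?_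
    simp_rw [hkey]
    rw [integral_finsetSum _ fun pq _ => (hintC pq.1 pq.2).const_mul _, Finset.mul_sum]
    refine Finset.sum_congr rfl fun pq hpq => ?_
    rw [Finset.HasAntidiagonal.mem_antidiagonal] at hpq
    rw [integral_const_mul, hpq]
    have hn : (((‖t‖ ^ (2 * m))⁻¹ : ℝ) : ℂ) = t⁻¹ ^ m * (starRingEnd ℂ t⁻¹) ^ m := by
      rw [← mul_pow, Complex.mul_conj, pow_mul, Complex.normSq_eq_norm_sq]
      push_cast
      simp
    rw [hn, pow_add, pow_add]
    ring
  rw [e2, ← mul_sub, ← integral_sub hintE (integrable_finsetSum _ fun n _ => hterm n), norm_mul]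
  rw [Complex.norm_real, Real.norm_eq_abs, abs_of_nonneg (by positivity)]
  have e3 : ‖∫ z : EuclideanSpace ℂ (Fin m) × EuclideanSpace ℂ (Fin m),
      (𝐞 ((gpQ z.2 z.1 * t⁻¹).re) • H (WithLp.toLp 2 z) -
      ∑ n ∈ Finset.range N, (((2 * Real.pi * (gpQ z.2 z.1 * t⁻¹).re : ℝ) : ℂ) * Complex.I) ^ n / (n.factorial : ℂ) *
          H (WithLp.toLp 2 z))‖ ≤
      ∫ z : EuclideanSpace ℂ (Fin m) × EuclideanSpace ℂ (Fin m),
        ((1 + Real.exp 1) * (2 * Real.pi) ^ N * ‖t‖⁻¹ ^ N) * (‖gpQ z.2 z.1‖ ^ N * ‖H (WithLp.toLp 2 z)‖) := by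
    refine norm_integral_le_of_norm_le ((hint N).const_mul _) (Eventually.of_forall fun z => ?_)
    rw [← Finset.sum_mul, Circle.smul_def, smul_eq_mul, ← sub_mul, norm_mul, Real.fourierChar_apply]
    rw [← mul_assoc]
    gcongr
    refine (gp_exp_bound N _).trans ?_
    have hr : (1 + Real.exp 1) * (2 * Real.pi) ^ N * ‖t‖⁻¹ ^ N * ‖gpQ z.2 z.1‖ ^ N =
        (1 + Real.exp 1) * ((2 * Real.pi) * (‖t‖⁻¹ * ‖gpQ z.2 z.1‖)) ^ N := by
      rw [mul_pow, mul_pow]; ring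
    rw [hr]
    gcongr
    rw [abs_mul, abs_of_pos (by positivity : (0 : ℝ) < 2 * Real.pi)]
    gcongr
    refine (Complex.abs_re_le_norm _).trans ?_
    rw [norm_mul, norm_inv, mul_comm]
  rw [integral_const_mul] at e3
  refine (mul_le_mul_of_nonneg_left e3 (by positivity)).trans (le_of_eq ?_)
  rw [pow_add, ← inv_pow]
  ring
end CoreExpand

section CorePush
open scoped FourierTransform RealInnerProductSpace

/-- coordinates -/
def gpLamL (m : ℕ) : WithLp 2 (EuclideanSpace ℂ (Fin m) × EuclideanSpace ℂ (Fin m)) ≃ₗ[ℝ]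
    (Fin (2 * m) → ℂ) where
  toFun w := fun k => if k.1 % 2 = 0 then w.fst ⟨k.1 / 2, by omega⟩ else w.snd ⟨k.1 / 2, by omega⟩
  map_add' w w' := by
    ext k
    by_cases h : k.1 % 2 = 0 <;> simp [h]
  map_smul' c w := by
    ext k
    by_cases h : k.1 % 2 = 0 <;> simp [h]
  invFun z := WithLp.toLp 2 (WithLp.toLp 2 (fun i => z ⟨2 * i.1, by omega⟩),
    WithLp.toLp 2 (fun i => z ⟨2 * i.1 + 1, by omega⟩))
  left_inv w := by
    apply WithLp.ofLp_injective
    apply Prod.ext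
    · ext i
      simp
    · ext i
      have h1 : (2 * i.1 + 1) / 2 = i.1 := by omega
      have h2 : (2 * i.1 + 1) % 2 = 1 := by omega
      simp [h1, h2]
  right_inv z := by
    ext k
    by_cases h : k.1 % 2 = 0
    · have : 2 * (k.1 / 2) = k.1 := by omega
      simp [h, this]
    · have : 2 * (k.1 / 2) + 1 = k.1 := by omega
      simp [this]
      intro h'
      exact absurd h' h

lemma gpLam_Q (m : ℕ) (x y : EuclideanSpace ℂ (Fin m)) :
    splitQC (2 * m) (gpLamL m (WithLp.toLp 2 (x, y))) = gpQ x y := by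
  unfold splitQC gpQ
  rw [if_pos (even_two_mul m), Nat.mul_div_cancel_left _ two_pos, Finset.sum_range]
  refine Finset.sum_congr rfl fun i _ => ?_
  unfold padC
  have h1 : 2 * i.1 < 2 * m := by omega
  have h2 : 2 * i.1 + 1 < 2 * m := by omega
  have h3 : (2 * i.1 + 1) / 2 = i.1 := by omega
  have h4 : (2 * i.1 + 1) % 2 = 1 := by omega
  rw [dif_pos h1, dif_pos h2]
  simp [gpLamL, h3, h4]

lemma gp_splitQC_cont (d : ℕ) : Continuous (splitQC d) := by
  have h : ∀ n, Continuous (fun z : Fin d → ℂ => padC z n) := by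
    intro n
    unfold padC
    by_cases h : n < d
    · simp only [h, dite_true]; fun_prop
    · simp only [h, dite_false]; fun_prop
  unfold splitQC
  by_cases hd : Even d
  · simp only [hd, if_true]; fun_prop
  · simp only [hd, if_false]; fun_prop

/-- Fourier transform of the pushforward -/
def gpA {d : ℕ} (Φ : SchwartzMap (Fin d → ℂ) ℂ) (t : ℂ) : ℂ :=
  ∫ z : Fin d → ℂ, 𝐞 (-⟪splitQC d z, t⟫) • Φ z

lemma gpA_cont {d : ℕ} (Φ : SchwartzMap (Fin d → ℂ) ℂ) : Continuous (gpA Φ) := by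
  have hq := gp_splitQC_cont d
  refine continuous_of_dominated (F := fun (t : ℂ) (z : Fin d → ℂ) => 𝐞 (-⟪splitQC d z, t⟫) • Φ z)
    (bound := fun z => ‖Φ z‖) ?_ ?_ ?_ ?_
  · intro p
    apply Continuous.aestronglyMeasurable
    simp only [Circle.smul_def]
    fun_prop
  · intro p
    refine Eventually.of_forall fun ζ => ?_
    rw [Circle.norm_smul]
  · exact Φ.integrable.norm
  · refine Eventually.of_forall fun ζ => ?_
    simp only [Circle.smul_def]
    fun_prop

theorem gpA_expand (m : ℕ) (Φ : SchwartzMap (Fin (2 * m) → ℂ) ℂ) :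
    ∃ a : ℕ → ℕ → ℂ, ∀ N : ℕ, ∃ C : ℝ, ∀ t : ℂ, t ≠ 0 →
    ‖gpA Φ t -
      ∑ n ∈ Finset.range N, ∑ pq ∈ Finset.HasAntidiagonal.antidiagonal n,
        a pq.1 pq.2 * (t⁻¹ ^ (pq.1 + m) * (starRingEnd ℂ t⁻¹) ^ (pq.2 + m))‖ ≤
      C * ‖t‖⁻¹ ^ (N + 2 * m) := by
  let Λ := (gpLamL m).toContinuousLinearEquiv
  let G := SchwartzMap.compCLMOfContinuousLinearEquiv ℂ Λ Φ
  obtain ⟨a, ha⟩ := gp_A0_expand G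
  have : (Measure.map Λ (volume : Measure (WithLp 2 (EuclideanSpace ℂ (Fin m) × EuclideanSpace ℂ (Fin m))))).IsAddHaarMeasure :=
    Λ.isAddHaarMeasure_map _
  obtain ⟨c, hc⟩ : ∃ c : NNReal, (volume : Measure (Fin (2 * m) → ℂ)) = c •
    Measure.map Λ (volume : Measure (WithLp 2 (EuclideanSpace ℂ (Fin m) × EuclideanSpace ℂ (Fin m)))) :=
    ⟨_, Measure.isAddLeftInvariant_eq_smul (volume : Measure (Fin (2 * m) → ℂ))
    (Measure.map Λ (volume : Measure (WithLp 2 (EuclideanSpace ℂ (Fin m) × EuclideanSpace ℂ (Fin m)))))⟩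
  have hme : MeasurableEmbedding Λ := Λ.toHomeomorph.measurableEmbedding
  have key : ∀ t, gpA Φ t = ((c : ℝ) : ℂ) * ∫ y : EuclideanSpace ℂ (Fin m), ∫ x : EuclideanSpace ℂ (Fin m),
        𝐞 (-⟪gpQ x y, t⟫) • G (WithLp.toLp 2 (x, y)) := by
    intro t
    unfold gpA
    rw [hc, integral_smul_nnreal_measure, hme.integral_map,
      ← (WithLp.volume_preserving_toLp (EuclideanSpace ℂ (Fin m)) (EuclideanSpace ℂ (Fin m))).integral_comp
      (MeasurableEquiv.toLp 2 _).measurableEmbedding, NNReal.smul_def, Complex.real_smul]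
    congr 1
    rw [Measure.volume_eq_prod, integral_prod_symm]
    · congr 1
      ext y
      congr 1
      ext x
      have := gpLam_Q m x y
      congr 4
    · refine Integrable.mono' (gp_prod_int G).norm ?_ (Eventually.of_forall fun z => ?_)
      · apply Continuous.aestronglyMeasurable
        simp only [Circle.smul_def]
        have := gp_splitQC_cont (2 * m)
        have : Continuous Λ := Λ.continuous
        fun_prop
      · rw [Circle.norm_smul]
        exact le_rfl
  refine ⟨fun p q => (c : ℝ) * a p q, fun N => ?_⟩
  obtain ⟨C, hC⟩ := ha N
  refine ⟨(c : ℝ) * C, fun t ht => ?_⟩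
  rw [key]
  have : ∀ (X : ℂ), (((c : ℝ) : ℂ) * X - ∑ n ∈ Finset.range N, ∑ pq ∈ Finset.HasAntidiagonal.antidiagonal n,
        (((c : ℝ) : ℂ) * a pq.1 pq.2) * (t⁻¹ ^ (pq.1 + m) * (starRingEnd ℂ t⁻¹) ^ (pq.2 + m))) =
      ((c : ℝ) : ℂ) * (X - ∑ n ∈ Finset.range N, ∑ pq ∈ Finset.HasAntidiagonal.antidiagonal n,
        a pq.1 pq.2 * (t⁻¹ ^ (pq.1 + m) * (starRingEnd ℂ t⁻¹) ^ (pq.2 + m))) := by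
    intro X
    simp_rw [mul_sub, Finset.mul_sum, mul_assoc]
  rw [this, norm_mul, Complex.norm_real, Real.norm_of_nonneg c.coe_nonneg, mul_assoc]
  exact mul_le_mul_of_nonneg_left (hC t ht) c.2
end CorePush

section LogFourier
open scoped FourierTransform RealInnerProductSpace

/-- kernel -/
def gpK (s : ℝ) (ξ : ℂ) : ℂ := (s : ℂ)⁻¹ * Complex.exp (-((Real.pi * s : ℝ) : ℂ) * (‖ξ‖ : ℂ) ^ 2)

/-- a function with logarithmic singularity at zero -/
def gpL (ξ : ℂ) : ℂ := ∫ s in Set.Ioi (1 : ℝ), gpK s ξ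

/-- monomials times `gpL` -/
def gpM (p q : ℕ) (ξ : ℂ) : ℂ := ξ ^ p * (starRingEnd ℂ ξ) ^ q * gpL ξ

lemma gpK_norm (s : ℝ) (hs : 1 < s) (ξ : ℂ) :
    ‖gpK s ξ‖ = s⁻¹ * Real.exp (-(Real.pi * s) * ‖ξ‖ ^ 2) := by
  unfold gpK
  rw [norm_mul, norm_inv, Complex.norm_real, Real.norm_of_nonneg (by linarith), Complex.norm_exp]
  congr 2
  norm_cast

lemma gp_exp_aux (s x : ℝ) (hs : 1 < s) (hx : 0 < x) :
    Real.exp (-(Real.pi * s) * x ^ 2) ≤ (√s)⁻¹ * x⁻¹ * Real.exp (-1 * x ^ 2) := by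
  have h0 : 0 < √s := Real.sqrt_pos.2 (by linarith)
  have h1 : √s * x ≤ Real.exp ((√s * x) ^ 2) := by
    have := Real.add_one_le_exp ((√s * x) ^ 2)
    nlinarith [sq_nonneg (√s * x - 1)]
  have h2 : (√s * x) ^ 2 = s * x ^ 2 := by rw [mul_pow, Real.sq_sqrt (by linarith)]
  rw [h2] at h1
  have h3 : (√s)⁻¹ * x⁻¹ = (√s * x)⁻¹ := by rw [mul_inv]
  rw [h3, inv_mul_eq_div, le_div_iff₀ (by positivity)]
  calc Real.exp (-(Real.pi * s) * x ^ 2) * (√s * x)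
      ≤ Real.exp (-(Real.pi * s) * x ^ 2) * Real.exp (s * x ^ 2) := by gcongr
    _ = Real.exp (-(Real.pi * s) * x ^ 2 + s * x ^ 2) := by rw [Real.exp_add]
    _ ≤ _ := by
      apply Real.exp_le_exp.2
      have h4 : 3 < Real.pi := Real.pi_gt_three
      have h5 : 0 < x ^ 2 := by positivity
      nlinarith [mul_pos (show 0 < s by linarith) h5, mul_pos (sub_pos.2 hs) h5,
        mul_pos (mul_pos (show 0 < s by linarith) h5) (sub_pos.2 h4)]

lemma gp_int_C (n : ℕ) : Integrable (fun ξ : ℂ => ‖ξ‖ ^ ((n : ℝ) - 1) * Real.exp (-1 * ‖ξ‖ ^ (2 : ℝ))) := by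
  by_contra h
  have h1 := Complex.integral_rpow_mul_exp_neg_mul_rpow (p := 2) (q := (n : ℝ) - 1) (b := 1)
    (by norm_num) (by linarith [(Nat.cast_nonneg n : (0 : ℝ) ≤ n)]) one_pos
  rw [integral_undef h] at h1
  have h2 : 0 < Real.Gamma (((n : ℝ) - 1 + 2) / 2) := Real.Gamma_pos_of_pos (by
    linarith [(Nat.cast_nonneg n : (0 : ℝ) ≤ n)])
  simp at h1
  exact h2.ne' h1

lemma gpK_int (p q : ℕ) : Integrable (fun z : ℂ × ℝ => z.1 ^ p * (starRingEnd ℂ z.1) ^ q * gpK z.2 z.1)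
    ((volume : Measure ℂ).prod (volume.restrict (Set.Ioi (1 : ℝ)))) := by
  have h1 : IntegrableOn (fun s : ℝ => s ^ (-(3 / 2) : ℝ)) (Set.Ioi 1) :=
    integrableOn_Ioi_rpow_of_lt (by norm_num) one_pos
  have h2 := (gp_int_C (p + q)).mul_prod h1
  refine Integrable.mono' h2 ?_ ?_
  · unfold gpK
    apply Measurable.aestronglyMeasurable
    have : Measurable (starRingEnd ℂ : ℂ → ℂ) := Complex.continuous_conj.measurable
    fun_prop
  · have hA : ∀ᵐ z : ℂ × ℝ ∂((volume : Measure ℂ).prod (volume.restrict (Set.Ioi (1 : ℝ)))), z.1 ≠ 0 := by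
      have : ∀ᵐ x : ℂ, x ≠ 0 := by
        rw [ae_iff]; simp
      exact Measure.quasiMeasurePreserving_fst.ae this
    have hB : ∀ᵐ z : ℂ × ℝ ∂((volume : Measure ℂ).prod (volume.restrict (Set.Ioi (1 : ℝ)))), 1 < z.2 := by
      have : ∀ᵐ x : ℝ ∂(volume.restrict (Set.Ioi (1 : ℝ))), 1 < x :=
        ae_restrict_mem measurableSet_Ioi
      exact Measure.quasiMeasurePreserving_snd.ae this
    filter_upwards [hA, hB] with z hz hs
    have hx : 0 < ‖z.1‖ := norm_pos_iff.2 hz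
    rw [norm_mul, norm_mul, norm_pow, norm_pow, RCLike.norm_conj, gpK_norm _ hs, ← pow_add]
    have h3 := gp_exp_aux z.2 ‖z.1‖ hs hx
    have h4 : z.2 ^ (-(3 / 2) : ℝ) = z.2⁻¹ * (√z.2)⁻¹ := by
      rw [Real.sqrt_eq_rpow, ← Real.rpow_neg_one, ← Real.rpow_neg (by linarith), ← Real.rpow_add (by linarith)]
      norm_num
    have h5 : ‖z.1‖ ^ (((p + q : ℕ) : ℝ) - 1) = ‖z.1‖ ^ (p + q) * ‖z.1‖⁻¹ := by
      rw [Real.rpow_sub_one hx.ne', Real.rpow_natCast, div_eq_mul_inv]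
    rw [h4, h5]
    have h6 : ‖z.1‖ ^ (2 : ℝ) = ‖z.1‖ ^ 2 := by norm_cast
    rw [h6]
    have hs0 : 0 < z.2 := by linarith
    calc ‖z.1‖ ^ (p + q) * (z.2⁻¹ * Real.exp (-(Real.pi * z.2) * ‖z.1‖ ^ 2))
        ≤ ‖z.1‖ ^ (p + q) * (z.2⁻¹ * ((√z.2)⁻¹ * ‖z.1‖⁻¹ * Real.exp (-1 * ‖z.1‖ ^ 2))) := by gcongr
      _ = _ := by ring

lemma gpM_int (p q : ℕ) : Integrable (gpM p q) := by
  have h := (gpK_int p q).integral_prod_left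
  refine h.congr (Eventually.of_forall fun ξ => ?_)
  simp only [gpM, gpL]
  rw [integral_const_mul]

lemma gp_tail_int (a : ℝ) (ha : 0 < a) :
    ∫ s in Set.Ioi (1 : ℝ), (s⁻¹ * s⁻¹) * Real.exp (-a * s⁻¹) = (1 - Real.exp (-a)) / a := by
  have hd : ∀ x ∈ Set.Ici (1 : ℝ), HasDerivAt (fun s : ℝ => a⁻¹ * Real.exp (-a * s⁻¹))
      ((x⁻¹ * x⁻¹) * Real.exp (-a * x⁻¹)) x := by
    intro x hx
    have hx0 : x ≠ 0 := by have : (1 : ℝ) ≤ x := hx; positivity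
    have h := (((hasDerivAt_inv hx0).const_mul (-a)).exp).const_mul a⁻¹
    rw [show x⁻¹ * x⁻¹ = (x ^ 2)⁻¹ by rw [sq, mul_inv]]
    have e : a⁻¹ * (Real.exp (-a * x⁻¹) * (-a * -(x ^ 2)⁻¹)) = (x ^ 2)⁻¹ * Real.exp (-a * x⁻¹) := by
      field_simp
    rw [← e]
    exact h
  have ht : Tendsto (fun s : ℝ => a⁻¹ * Real.exp (-a * s⁻¹)) atTop (nhds a⁻¹) := by
    have h1 : Tendsto (fun s : ℝ => a⁻¹ * Real.exp (-a * s⁻¹)) atTop (nhds (a⁻¹ * Real.exp (-a * 0))) :=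
      ((Real.continuous_exp.tendsto _).comp ((tendsto_inv_atTop_zero).const_mul (-a))).const_mul a⁻¹
    simpa using h1
  rw [integral_Ioi_of_hasDerivAt_of_nonneg' hd (fun x _ => mul_nonneg (mul_self_nonneg _) (Real.exp_pos _).le) ht]
  simp
  field_simp

lemma gpM_zero_fourier (t : ℂ) (ht : t ≠ 0) :
    𝓕 (gpM 0 0) t = ((1 - Real.exp (-(Real.pi * ‖t‖ ^ 2))) / (Real.pi * ‖t‖ ^ 2) : ℝ) := by
  have hK := gpK_int 0 0
  simp only [pow_zero, one_mul] at hK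
  have e1 : 𝓕 (gpM 0 0) t = ∫ ξ : ℂ, ∫ s in Set.Ioi (1 : ℝ), 𝐞 (-⟪ξ, t⟫) • gpK s ξ := by
    rw [Real.fourier_eq]
    congr 1
    ext ξ
    simp only [gpM, gpL, pow_zero, one_mul, Circle.smul_def]
    rw [integral_smul]
  rw [e1, integral_integral_swap]
  · rw [← gp_tail_int (Real.pi * ‖t‖ ^ 2) (by have := norm_pos_iff.2 ht; positivity), ← integral_complex_ofReal]
    refine setIntegral_congr_fun measurableSet_Ioi fun s hs => ?_
    have hs0 : 0 < s := lt_trans one_pos hs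
    have h := fourier_gaussian_innerProductSpace (V := ℂ) (b := ((Real.pi * s : ℝ) : ℂ))
      (by rw [Complex.ofReal_re]; positivity) t
    rw [Real.fourier_eq] at h
    simp only [gpK]
    have h2 : ∀ ξ : ℂ, 𝐞 (-⟪ξ, t⟫) • ((s : ℂ)⁻¹ * Complex.exp (-((Real.pi * s : ℝ) : ℂ) * (‖ξ‖ : ℂ) ^ 2)) =
      (s : ℂ)⁻¹ * 𝐞 (-⟪ξ, t⟫) • (Complex.exp (-((Real.pi * s : ℝ) : ℂ) * (‖ξ‖ : ℂ) ^ 2)) := by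
      intro ξ
      simp only [Circle.smul_def, smul_eq_mul]; ring
    simp_rw [h2]
    rw [integral_const_mul, h]
    have hs0' : (s : ℂ) ≠ 0 := by exact_mod_cast hs0.ne'
    have hpi : (Real.pi : ℂ) ≠ 0 := by exact_mod_cast Real.pi_ne_zero
    rw [Complex.finrank_real_complex]
    push_cast
    rw [show ((2 : ℂ) / 2) = 1 by norm_num, Complex.cpow_one, mul_assoc]
    congr 2
    · field_simp
    · congr 1
      field_simp
  · refine Integrable.mono hK ?_ (Eventually.of_forall fun z => ?_)
    · refine AEStronglyMeasurable.congr (f := fun z : ℂ × ℝ => ((𝐞 (-⟪z.1, t⟫) : Circle) : ℂ) * gpK z.2 z.1) ?_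
        (Eventually.of_forall fun z => by simp [Function.uncurry, Circle.smul_def])
      refine AEStronglyMeasurable.mul ?_ hK.aestronglyMeasurable
      apply Continuous.aestronglyMeasurable
      fun_prop
    · simp only [Function.uncurry]
      rw [Circle.norm_smul]
end LogFourier

section LogFourierDeriv
open scoped FourierTransform RealInnerProductSpace

/-- Wirtinger derivatives off zero -/
def gpW (F A B : ℂ → ℂ) : Prop := ∀ t : ℂ, t ≠ 0 →
  HasFDerivAt F (A t • (ContinuousLinearMap.id ℝ ℂ) + B t • (Complex.conjCLE : ℂ →L[ℝ] ℂ)) t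

lemma gpW_add {F A B F' A' B' : ℂ → ℂ} (h : gpW F A B) (h' : gpW F' A' B') :
    gpW (fun t => F t + F' t) (fun t => A t + A' t) (fun t => B t + B' t) := by
  intro t ht
  have := (h t ht).add (h' t ht)
  refine this.congr_fderiv ?_
  ext w <;> simp <;> ring

lemma gpW_mono (c e : ℂ) (i j : ℤ) :
    gpW (fun t => c * (t ^ i * (starRingEnd ℂ t) ^ j * Complex.exp (e * (t * starRingEnd ℂ t))))
    (fun t => (c * i) * (t ^ (i - 1) * (starRingEnd ℂ t) ^ j * Complex.exp (e * (t * starRingEnd ℂ t))) +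
      (c * e) * (t ^ i * (starRingEnd ℂ t) ^ (j + 1) * Complex.exp (e * (t * starRingEnd ℂ t))))
    (fun t => (c * j) * (t ^ i * (starRingEnd ℂ t) ^ (j - 1) * Complex.exp (e * (t * starRingEnd ℂ t))) +
      (c * e) * (t ^ (i + 1) * (starRingEnd ℂ t) ^ j * Complex.exp (e * (t * starRingEnd ℂ t)))) := by
  intro t ht
  have ht' : starRingEnd ℂ t ≠ 0 := by simpa using ht
  have hid : HasFDerivAt (fun t : ℂ => t) (ContinuousLinearMap.id ℝ ℂ) t := hasFDerivAt_id t
  have hcj : HasFDerivAt (fun t : ℂ => starRingEnd ℂ t) (Complex.conjCLE : ℂ →L[ℝ] ℂ) t :=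
    Complex.conjCLE.hasFDerivAt
  have h1 := (hasDerivAt_zpow i t (Or.inl ht)).comp_hasFDerivAt t hid
  have h2 := (hasDerivAt_zpow j (starRingEnd ℂ t) (Or.inl ht')).comp_hasFDerivAt t hcj
  have h3 := ((hid.mul hcj).const_mul e)
  have h4 := (Complex.hasDerivAt_exp (e * (t * starRingEnd ℂ t))).comp_hasFDerivAt t h3
  have h5 := (((h1.mul h2).mul h4).const_mul c)
  refine h5.congr_fderiv ?_
  ext w <;> simp [zpow_add_one₀ ht, zpow_add_one₀ ht'] <;> ring

/-- rapidly decaying remainders -/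
inductive gpRem : (ℂ → ℂ) → Prop
  | mono (c : ℂ) (i j : ℤ) : gpRem (fun t => c * (t ^ i * (starRingEnd ℂ t) ^ j *
      Complex.exp (-(Real.pi : ℂ) * (t * starRingEnd ℂ t))))
  | add (F G : ℂ → ℂ) : gpRem F → gpRem G → gpRem (fun t => F t + G t)

lemma gpRem_W {F : ℂ → ℂ} (h : gpRem F) : ∃ A B, gpRem A ∧ gpRem B ∧ gpW F A B := by
  induction h with
  | mono c i j => exact ⟨_, _, .add _ _ (.mono _ _ _) (.mono _ _ _), .add _ _ (.mono _ _ _) (.mono _ _ _), gpW_mono c _ i j⟩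
  | add F G _ _ h1 h2 =>
    obtain ⟨A, B, hA, hB, hW⟩ := h1
    obtain ⟨A', B', hA', hB', hW'⟩ := h2
    exact ⟨_, _, .add _ _ hA hA', .add _ _ hB hB', gpW_add hW hW'⟩

lemma gpRem_smul {F : ℂ → ℂ} (h : gpRem F) (k : ℂ) : gpRem (fun t => k * F t) := by
  induction h with
  | mono c i j =>
    have := gpRem.mono (k * c) i j
    simp only [mul_assoc] at this ⊢
    exact this
  | add F G _ _ h1 h2 =>
    have := gpRem.add _ _ h1 h2
    simp only [mul_add]
    exact this

lemma gpRem_decay {F : ℂ → ℂ} (h : gpRem F) (K : ℕ) : ∃ C : ℝ, ∀ t : ℂ, 1 ≤ ‖t‖ →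
    ‖F t‖ ≤ C * ‖t‖⁻¹ ^ K := by
  induction h with
  | mono c i j =>
    let n := (i + j).natAbs + K
    refine ⟨‖c‖ * (Nat.factorial n), fun t ht => ?_⟩
    have hx : 0 < ‖t‖ := by linarith
    have e1 : ‖Complex.exp (-(Real.pi : ℂ) * (t * starRingEnd ℂ t))‖ ≤ Real.exp (-‖t‖) := by
      rw [Complex.norm_exp, Complex.mul_conj, Complex.normSq_eq_norm_sq]
      apply Real.exp_le_exp.2
      have : (-(Real.pi : ℂ) * ((‖t‖ ^ 2 : ℝ) : ℂ)).re = -Real.pi * ‖t‖ ^ 2 := by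
        norm_cast
      rw [this]
      nlinarith [Real.pi_gt_three]
    rw [norm_mul, norm_mul, norm_mul, norm_zpow, norm_zpow, RCLike.norm_conj, ← zpow_add₀ hx.ne', mul_assoc]
    refine mul_le_mul_of_nonneg_left ?_ (norm_nonneg _)
    have e2 : ‖t‖ ^ (i + j) ≤ ‖t‖ ^ (i + j).natAbs := by
      rw [← zpow_natCast]
      exact zpow_le_zpow_right₀ ht Int.le_natAbs
    have e3 := Real.pow_div_factorial_le_exp ‖t‖ hx.le n
    rw [div_le_iff₀ (by positivity)] at e3
    calc _ ≤ ‖t‖ ^ (i + j).natAbs * Real.exp (-‖t‖) := by gcongr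
      _ = ‖t‖ ^ n * Real.exp (-‖t‖) * ‖t‖⁻¹ ^ K := by
        simp only [n, pow_add, inv_pow]
        field_simp
      _ ≤ (Real.exp ‖t‖ * (Nat.factorial n)) * Real.exp (-‖t‖) * ‖t‖⁻¹ ^ K := by gcongr
      _ = _ := by
        rw [Real.exp_neg]
        field_simp
  | add F G _ _ h1 h2 =>
    obtain ⟨C, hC⟩ := h1
    obtain ⟨C', hC'⟩ := h2
    refine ⟨C + C', fun t ht => (norm_add_le _ _).trans ?_⟩
    rw [add_mul]
    exact add_le_add (hC t ht) (hC' t ht)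

lemma gp_fourier_deriv {h F A B : ℂ → ℂ} (hi : Integrable h) (hi' : Integrable (fun v => ‖v‖ * ‖h v‖))
    (hF : ∀ t, t ≠ 0 → 𝓕 h t = F t) (hW : gpW F A B) (t : ℂ) (ht : t ≠ 0) :
    𝓕 (fun v => v * h v) t = (Complex.I / Real.pi) * B t ∧
    𝓕 (fun v => starRingEnd ℂ v * h v) t = (Complex.I / Real.pi) * A t := by
  have h1 := Real.hasFDerivAt_fourier hi hi' t
  have h2 : HasFDerivAt (𝓕 h) _ t := (hW t ht).congr_of_eventuallyEq
    (by filter_upwards [isOpen_ne.mem_nhds ht] with s hs using hF s hs)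
  have h3 := h1.unique h2
  have hsm : Integrable (VectorFourier.fourierSMulRight (innerSL ℝ) h) := by
    refine (hi'.const_mul (2 * Real.pi)).mono' ?_ ?_
    · exact hi.1.fourierSMulRight
    · refine Eventually.of_forall fun v => ?_
      rw [VectorFourier.norm_fourierSMulRight]
      rw [innerSL_apply_norm, mul_assoc]
  have hin : ∀ v w : ℂ, VectorFourier.fourierSMulRight (innerSL ℝ) h v w =
      -(2 * Real.pi * Complex.I) * (((⟪v, w⟫ : ℝ) : ℂ) * h v) := by
    intro v w
    rw [VectorFourier.fourierSMulRight_apply, smul_eq_mul, Complex.real_smul]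
    rfl
  have h4 : ∀ w : ℂ, 𝓕 (fun v => -(2 * Real.pi * Complex.I) * ((⟪v, w⟫ : ℝ) * h v)) t = A t * w + B t * starRingEnd ℂ w := by
    intro w
    have := congrArg (fun D : ℂ →L[ℝ] ℂ => D w) h3
    beta_reduce at this
    rw [Real.fourier_continuousLinearMap_apply hsm] at this
    simp only [hin] at this
    rw [this]
    simp
  have hint : ∀ w : ℂ, Integrable (fun v => -(2 * Real.pi * Complex.I) * (((⟪v, w⟫ : ℝ) : ℂ) * h v)) := by
    intro w
    have := hsm.apply_continuousLinearMap w
    simp only [hin] at this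
    exact this
  have hchar : ∀ w : ℂ, Integrable (fun v => ((𝐞 (-⟪v, t⟫) : Circle) : ℂ) *
      (-(2 * Real.pi * Complex.I) * (((⟪v, w⟫ : ℝ) : ℂ) * h v))) := by
    intro w
    refine (hint w).mono ?_ (Eventually.of_forall fun v => ?_)
    · refine AEStronglyMeasurable.mul ?_ (hint w).aestronglyMeasurable
      apply Continuous.aestronglyMeasurable
      fun_prop
    · rw [norm_mul, Circle.norm_coe, one_mul]
  have key : ∀ k : ℂ, 𝓕 (fun v => -(2 * Real.pi * Complex.I) * (((⟪v, 1⟫ : ℝ) : ℂ) * h v)) t + k * 𝓕 (fun v => -(2 * Real.pi * Complex.I) * (((⟪v, Complex.I⟫ : ℝ) : ℂ) * h v)) t = -(2 * Real.pi * Complex.I) * 𝓕 (fun v => (v.re + k * v.im) * h v) t := by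
    intro k
    simp only [Real.fourier_eq, Circle.smul_def, smul_eq_mul]
    rw [← integral_const_mul, ← integral_const_mul, ← integral_add]
    · congr 1
      ext v
      simp [Complex.inner]
      ring
    · exact hchar 1
    · exact (hchar Complex.I).const_mul k
  have hpi : (Real.pi : ℂ) ≠ 0 := by exact_mod_cast Real.pi_ne_zero
  constructor
  · have k1 := key Complex.I
    rw [h4, h4] at k1
    have e : (fun v : ℂ => ((v.re : ℂ) + Complex.I * v.im) * h v) = fun v => v * h v := by
      ext v
      rw [mul_comm Complex.I, Complex.re_add_im]
    rw [e, map_one, Complex.conj_I] at k1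
    have k2 : 2 * B t = -(2 * Real.pi * Complex.I) * 𝓕 (fun v => v * h v) t := by
      rw [← k1]
      ring_nf
      rw [Complex.I_sq]; ring
    field_simp
    linear_combination (-Complex.I / 2) * k2 + (𝓕 (fun v => v * h v) t) * Real.pi * Complex.I_sq
  · have k1 := key (-Complex.I)
    rw [h4, h4] at k1
    have e : (fun v : ℂ => ((v.re : ℂ) + -Complex.I * v.im) * h v) = fun v => starRingEnd ℂ v * h v := by
      ext v
      congr 1
      apply Complex.ext <;> simp
    rw [e, map_one, Complex.conj_I] at k1
    have k2 : 2 * A t = -(2 * Real.pi * Complex.I) * 𝓕 (fun v => starRingEnd ℂ v * h v) t := by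
      rw [← k1]
      ring_nf
      rw [Complex.I_sq]; ring
    field_simp
    linear_combination (-Complex.I / 2) * k2 + (𝓕 (fun v => starRingEnd ℂ v * h v) t) * Real.pi * Complex.I_sq

lemma gpM_int' (p q : ℕ) : Integrable (fun v => ‖v‖ * ‖gpM p q v‖) := by
  refine (gpM_int (p + 1) q).norm.congr (Eventually.of_forall fun v => ?_)
  simp only [gpM, norm_mul, norm_pow]
  ring

lemma gpM_fourier (p q : ℕ) : ∃ c : ℂ, c ≠ 0 ∧ ∃ R, gpRem R ∧ ∀ t : ℂ, t ≠ 0 →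
    𝓕 (gpM p q) t = c * (t ^ (-(q + 1 : ℤ)) * (starRingEnd ℂ t) ^ (-(p + 1 : ℤ))) + R t := by
  have hpi : (Real.pi : ℂ) ≠ 0 := by exact_mod_cast Real.pi_ne_zero
  induction p generalizing q with
  | zero =>
    induction q with
    | zero =>
      refine ⟨(Real.pi : ℂ)⁻¹, inv_ne_zero hpi, _, gpRem.mono (-(Real.pi : ℂ)⁻¹) (-1) (-1), fun t ht => ?_⟩
      have ht' : starRingEnd ℂ t ≠ 0 := by simpa using ht
      rw [gpM_zero_fourier t ht]
      push_cast
      have e : ((‖t‖ : ℂ)) ^ 2 = t * starRingEnd ℂ t := by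
        rw [Complex.mul_conj, Complex.normSq_eq_norm_sq]; push_cast; rfl
      rw [e]
      simp
      field_simp
      ring
    | succ q ih =>
      obtain ⟨c, hc, R, hR, hF⟩ := ih
      obtain ⟨A, B, hA, hB, hW⟩ := gpRem_W hR
      have hW1 := gpW_mono c 0 (-(q + 1 : ℤ)) (-(((0 : ℕ) : ℤ) + 1))
      have hW2 := gpW_add hW1 hW
      refine ⟨(Complex.I / Real.pi) * (c * (-(q + 1 : ℤ) : ℤ)), ?_, _, gpRem_smul hA (Complex.I / Real.pi), fun t ht => ?_⟩
      · refine mul_ne_zero (div_ne_zero Complex.I_ne_zero hpi) (mul_ne_zero hc ?_)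
        rw [Int.cast_ne_zero]
        omega
      have h := (gp_fourier_deriv (gpM_int 0 q) (gpM_int' 0 q) (fun t ht => by
        rw [hF t ht]; simp only [zero_mul, Complex.exp_zero, mul_one]) hW2 t ht).2
      have e : gpM 0 (q + 1) = fun v => starRingEnd ℂ v * gpM 0 q v := by
        ext v; simp only [gpM]; ring
      rw [e, h]
      simp only [zero_mul, Complex.exp_zero, mul_one, mul_zero, add_zero]
      rw [show -(((q + 1 : ℕ) : ℤ) + 1) = -(q + 1 : ℤ) - 1 by push_cast; ring]
      ring
  | succ p ih =>
    obtain ⟨c, hc, R, hR, hF⟩ := ih q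
    obtain ⟨A, B, hA, hB, hW⟩ := gpRem_W hR
    have hW1 := gpW_mono c 0 (-(q + 1 : ℤ)) (-(p + 1 : ℤ))
    have hW2 := gpW_add hW1 hW
    refine ⟨(Complex.I / Real.pi) * (c * (-(p + 1 : ℤ) : ℤ)), ?_, _, gpRem_smul hB (Complex.I / Real.pi), fun t ht => ?_⟩
    · refine mul_ne_zero (div_ne_zero Complex.I_ne_zero hpi) (mul_ne_zero hc ?_)
      rw [Int.cast_ne_zero]
      omega
    have h := (gp_fourier_deriv (gpM_int p q) (gpM_int' p q) (fun t ht => by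
      rw [hF t ht]; simp only [zero_mul, Complex.exp_zero, mul_one]) hW2 t ht).1
    have e : gpM (p + 1) q = fun v => v * gpM p q v := by
      ext v; simp only [gpM]; ring
    rw [e, h]
    simp only [zero_mul, Complex.exp_zero, mul_one, mul_zero, add_zero]
    rw [show -(((p + 1 : ℕ) : ℤ) + 1) = -(p + 1 : ℤ) - 1 by push_cast; ring]
    ring

/-- asymptotics of the Fourier transform of `gpM`. -/
theorem gpM_asymp (p q : ℕ) : ∃ c : ℂ, c ≠ 0 ∧ ∀ K : ℕ, ∃ C : ℝ, ∀ t : ℂ, 1 ≤ ‖t‖ →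
    ‖𝓕 (gpM p q) t - c * (t⁻¹ ^ (q + 1) * (starRingEnd ℂ t⁻¹) ^ (p + 1))‖ ≤ C * ‖t‖⁻¹ ^ K := by
  obtain ⟨c, hc, R, hR, hF⟩ := gpM_fourier p q
  refine ⟨c, hc, fun K => ?_⟩
  obtain ⟨C, hC⟩ := gpRem_decay hR K
  refine ⟨C, fun t ht => ?_⟩
  have ht0 : t ≠ 0 := by
    rintro rfl
    simp at ht
    linarith
  have e : 𝓕 (gpM p q) t - c * (t⁻¹ ^ (q + 1) * (starRingEnd ℂ t⁻¹) ^ (p + 1)) = R t := by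
    rw [hF t ht0, map_inv₀, inv_pow, inv_pow, zpow_neg, zpow_neg]
    norm_cast
    ring
  rw [e]
  exact hC t ht

end LogFourierDeriv

section LogExpand

/-- `(1 - exp (-s)) / s`. -/
def gpk (s : ℝ) : ℂ := dslope (fun z : ℂ => 1 - Complex.exp (-z)) 0 (s : ℂ)

lemma gpk_contDiff (n : ℕ) : ContDiff ℝ n gpk := by
  have h1 : DifferentiableOn ℂ (dslope (fun z : ℂ => 1 - Complex.exp (-z)) 0) Set.univ := by
    rw [Complex.differentiableOn_dslope Filter.univ_mem]
    apply Differentiable.differentiableOn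
    fun_prop
  have h2 : ContDiff ℂ n (dslope (fun z : ℂ => 1 - Complex.exp (-z)) 0) :=
    (differentiableOn_univ.1 h1).contDiff
  exact (h2.restrict_scalars ℝ).comp Complex.ofRealCLM.contDiff

lemma gpk_eq (s : ℝ) (hs : 0 < s) : gpk s = (s : ℂ)⁻¹ - (s : ℂ)⁻¹ * Complex.exp (-s) := by
  unfold gpk
  have : (s : ℂ) ≠ 0 := by exact_mod_cast hs.ne'
  rw [dslope_of_ne _ this, slope_def_field]
  simp
  field_simp

lemma gp_prim_contDiff (n : ℕ) : ContDiff ℝ n (fun x : ℝ => ∫ u in (1 : ℝ)..x, gpk u) := by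
  have hc : Continuous gpk := (gpk_contDiff 0).continuous
  have hd : ∀ x, HasDerivAt (fun x : ℝ => ∫ u in (1 : ℝ)..x, gpk u) (gpk x) x := fun x =>
    hc.integral_hasStrictDerivAt 1 x |>.hasDerivAt
  have h : ContDiff ℝ ((n : WithTop ℕ∞) + 1) (fun x : ℝ => ∫ u in (1 : ℝ)..x, gpk u) := by
    rw [contDiff_succ_iff_deriv]
    refine ⟨fun x => (hd x).differentiableAt, fun h => by simp at h, ?_⟩
    rw [show deriv (fun x : ℝ => ∫ u in (1 : ℝ)..x, gpk u) = gpk from funext fun x => (hd x).deriv]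
    exact gpk_contDiff n
  exact h.of_le (by exact_mod_cast Nat.le_succ n)

lemma gp_E_int (x : ℝ) (hx : 0 < x) :
    IntegrableOn (fun u : ℝ => (u : ℂ)⁻¹ * Complex.exp (-u)) (Set.Ioi x) := by
  have h : IntegrableOn (fun u : ℝ => x⁻¹ * Real.exp (-u)) (Set.Ioi x) :=
    (integrableOn_exp_neg_Ioi x).const_mul _
  refine Integrable.mono' h ?_ ?_
  · apply Measurable.aestronglyMeasurable
    fun_prop
  · filter_upwards [ae_restrict_mem measurableSet_Ioi] with u hu
    have hu : x < u := hu
    rw [norm_mul, norm_inv, Complex.norm_real, Complex.norm_exp, Real.norm_of_nonneg (by linarith)]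
    simp only [Complex.neg_re, Complex.ofReal_re]
    gcongr

lemma gp_E_eq (x : ℝ) (hx : 0 < x) :
    ∫ u in Set.Ioi x, (u : ℂ)⁻¹ * Complex.exp (-u) =
    (∫ u in Set.Ioi (1 : ℝ), (u : ℂ)⁻¹ * Complex.exp (-u)) - (Real.log x : ℝ) + ∫ u in (1 : ℝ)..x, gpk u := by
  have h := intervalIntegral.integral_interval_add_Ioi (gp_E_int 1 one_pos) (gp_E_int x hx)
  rw [← h]
  have hpos : ∀ u ∈ Set.uIcc 1 x, 0 < u := by
    intro u hu
    exact lt_of_lt_of_le (lt_min one_pos hx) hu.1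
  have e1 : ∫ u in (1 : ℝ)..x, (u : ℂ)⁻¹ * Complex.exp (-u) = ∫ u in (1 : ℝ)..x, (((u⁻¹ : ℝ) : ℂ) - gpk u) := by
    refine intervalIntegral.integral_congr fun u hu => ?_
    simp only [gpk_eq u (hpos u hu)]
    push_cast
    ring
  rw [e1, intervalIntegral.integral_sub, intervalIntegral.integral_ofReal, integral_inv_of_pos one_pos hx, div_one]
  · ring
  · apply ContinuousOn.intervalIntegrable
    apply Complex.continuous_ofReal.comp_continuousOn
    exact continuousOn_inv₀.mono fun u hu => (hpos u hu).ne'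
  · exact (gpk_contDiff 0).continuous.intervalIntegrable _ _

theorem gpL_log : ∃ S : ℂ → ℂ, (∀ n : ℕ, ContDiff ℝ n S) ∧ ∀ ξ : ℂ, ξ ≠ 0 →
    gpL ξ = -2 * ((Real.log ‖ξ‖ : ℝ) : ℂ) + S ξ := by
  refine ⟨fun ξ => ((∫ u in Set.Ioi (1 : ℝ), (u : ℂ)⁻¹ * Complex.exp (-u)) - (Real.log Real.pi : ℝ)) +
    ∫ u in (1 : ℝ)..(Real.pi * ‖ξ‖ ^ 2), gpk u, fun n => ?_, fun ξ hξ => ?_⟩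
  · refine contDiff_const.add ((gp_prim_contDiff n).comp ?_)
    exact contDiff_const.mul (contDiff_norm_sq ℝ)
  · have hx0 : 0 < ‖ξ‖ := norm_pos_iff.2 hξ
    have hx : 0 < Real.pi * ‖ξ‖ ^ 2 := by positivity
    have h := gp_E_eq _ hx
    have e : gpL ξ = ∫ u in Set.Ioi (Real.pi * ‖ξ‖ ^ 2), (u : ℂ)⁻¹ * Complex.exp (-u) := by
      have := integral_comp_mul_left_Ioi (fun u : ℝ => (u : ℂ)⁻¹ * Complex.exp (-u)) 1 hx
      rw [mul_one] at this
      unfold gpL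
      have h2 : ∀ s : ℝ, gpK s ξ = ((Real.pi * ‖ξ‖ ^ 2 : ℝ) : ℂ) * ((((Real.pi * ‖ξ‖ ^ 2) * s : ℝ) : ℂ)⁻¹ *
          Complex.exp (-((Real.pi * ‖ξ‖ ^ 2) * s : ℝ))) := by
        intro s
        unfold gpK
        have hx' : ((Real.pi * ‖ξ‖ ^ 2 : ℝ) : ℂ) ≠ 0 := by exact_mod_cast hx.ne'
        rw [Complex.ofReal_mul (Real.pi * ‖ξ‖ ^ 2) s, mul_inv, ← mul_assoc, mul_inv_cancel_left₀ hx']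
        congr 2
        push_cast
        ring
      simp_rw [h2]
      rw [integral_const_mul, this, Complex.real_smul, ← mul_assoc, ← Complex.ofReal_mul, mul_inv_cancel₀ hx.ne']
      simp
    rw [e, h, Real.log_mul Real.pi_ne_zero (by positivity), Real.log_pow]
    push_cast
    ring
end LogExpand

section FourierSmooth
open scoped FourierTransform RealInnerProductSpace

lemma gp_decay_int {R : ℂ → ℂ} (hR : Continuous R) (k : ℕ) {C : ℝ}
    (hC : ∀ t : ℂ, 1 ≤ ‖t‖ → ‖R t‖ ≤ C * ‖t‖⁻¹ ^ (k + 3)) (n : ℕ) (hn : n ≤ k) :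
    Integrable (fun v => ‖v‖ ^ n * ‖R v‖) := by
  obtain ⟨B, hB⟩ := (isCompact_closedBall (0 : ℂ) 1).exists_bound_of_continuousOn hR.continuousOn
  have h := integrable_one_add_norm (E := ℂ) (μ := volume) (r := 3) (by
    rw [Complex.finrank_real_complex]; norm_num)
  refine (h.const_mul (8 * (|B| + |C|))).mono' ?_ (Eventually.of_forall fun v => ?_)
  · apply Continuous.aestronglyMeasurable
    fun_prop
  · rw [Real.norm_of_nonneg (by positivity)]
    have e : (1 + ‖v‖) ^ (-3 : ℝ) = ((1 + ‖v‖) ^ 3)⁻¹ := by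
      rw [Real.rpow_neg (by positivity)]
      norm_cast
    rw [e, ← div_eq_mul_inv, le_div_iff₀ (by positivity)]
    by_cases hv : ‖v‖ ≤ 1
    · have h1 : ‖R v‖ ≤ |B| := (hB v (by simpa using hv)).trans (le_abs_self _)
      have h2 : ‖v‖ ^ n ≤ 1 := pow_le_one₀ (norm_nonneg _) hv
      have h3 : (1 + ‖v‖) ^ 3 ≤ 8 := by
        calc (1 + ‖v‖) ^ 3 ≤ (1 + 1) ^ 3 := by gcongr
          _ = 8 := by norm_num
      calc ‖v‖ ^ n * ‖R v‖ * (1 + ‖v‖) ^ 3 ≤ 1 * |B| * 8 := by gcongr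
        _ ≤ _ := by linarith [abs_nonneg C]
    · push Not at hv
      have h1 : ‖R v‖ ≤ |C| * ‖v‖⁻¹ ^ (k + 3) := (hC v hv.le).trans (by gcongr; exact le_abs_self _)
      have hv0 : 0 < ‖v‖ := by linarith
      have h2 : ‖v‖ ^ n ≤ ‖v‖ ^ k := pow_le_pow_right₀ hv.le hn
      have h3 : (1 + ‖v‖) ^ 3 ≤ 8 * ‖v‖ ^ 3 := by
        calc (1 + ‖v‖) ^ 3 ≤ (‖v‖ + ‖v‖) ^ 3 := by gcongr
          _ = 8 * ‖v‖ ^ 3 := by ring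
      calc ‖v‖ ^ n * ‖R v‖ * (1 + ‖v‖) ^ 3 ≤ ‖v‖ ^ k * (|C| * ‖v‖⁻¹ ^ (k + 3)) * (8 * ‖v‖ ^ 3) := by gcongr
        _ = 8 * |C| := by
          rw [inv_pow, pow_add]
          field_simp
        _ ≤ _ := by linarith [abs_nonneg B]

lemma gp_decay_int0 {R : ℂ → ℂ} (hR : Continuous R) (k : ℕ) {C : ℝ}
    (hC : ∀ t : ℂ, 1 ≤ ‖t‖ → ‖R t‖ ≤ C * ‖t‖⁻¹ ^ (k + 3)) : Integrable R := by
  have := gp_decay_int hR k hC 0 (Nat.zero_le _)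
  simp only [pow_zero, one_mul] at this
  exact (integrable_norm_iff hR.aestronglyMeasurable).1 this

lemma gp_inv_contDiff {R : ℂ → ℂ} (hR : Continuous R) (k : ℕ) {C : ℝ}
    (hC : ∀ t : ℂ, 1 ≤ ‖t‖ → ‖R t‖ ≤ C * ‖t‖⁻¹ ^ (k + 3)) : ContDiff ℝ k (𝓕⁻ R) := by
  have h := Real.contDiff_fourier (f := R) (N := k) (fun n hn =>
    gp_decay_int hR k hC n (by exact_mod_cast hn))
  have e : 𝓕⁻ R = fun w => 𝓕 R (-w) := by
    ext w
    rw [Real.fourierInv_eq_fourier_neg]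
  rw [e]
  have h' : ContDiff ℝ k (𝓕 R) := by exact_mod_cast h
  exact h'.comp contDiff_neg

lemma gp_fourier_cont {f : ℂ → ℂ} (hf : Integrable f) : Continuous (𝓕 f) := by
  have h := Real.contDiff_fourier (f := f) (N := 0) (fun n hn => by
    have : n = 0 := by exact_mod_cast (nonpos_iff_eq_zero.1 hn)
    subst this
    simpa using hf.norm)
  exact h.continuous

lemma gpM_decay (p q : ℕ) : ∃ C : ℝ, ∀ t : ℂ, 1 ≤ ‖t‖ → ‖𝓕 (gpM p q) t‖ ≤ C * ‖t‖⁻¹ ^ (p + q + 2) := by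
  obtain ⟨c, -, h⟩ := gpM_asymp p q
  obtain ⟨C, hC⟩ := h (p + q + 2)
  refine ⟨C + ‖c‖, fun t ht => ?_⟩
  have h1 := hC t ht
  have h2 : ‖c * (t⁻¹ ^ (q + 1) * (starRingEnd ℂ t⁻¹) ^ (p + 1))‖ = ‖c‖ * ‖t‖⁻¹ ^ (p + q + 2) := by
    rw [norm_mul, norm_mul, norm_pow, norm_pow, RCLike.norm_conj, norm_inv, ← pow_add]
    congr 2
    ring
  calc _ = ‖(𝓕 (gpM p q) t - c * (t⁻¹ ^ (q + 1) * (starRingEnd ℂ t⁻¹) ^ (p + 1))) +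
        c * (t⁻¹ ^ (q + 1) * (starRingEnd ℂ t⁻¹) ^ (p + 1))‖ := by rw [sub_add_cancel]
    _ ≤ _ := norm_add_le _ _
    _ ≤ C * ‖t‖⁻¹ ^ (p + q + 2) + ‖c‖ * ‖t‖⁻¹ ^ (p + q + 2) := add_le_add h1 h2.le
    _ = _ := by ring

/-- monomial times logarithm -/
def gpG (p q : ℕ) (ξ : ℂ) : ℂ := ξ ^ p * (starRingEnd ℂ ξ) ^ q * ((Real.log ‖ξ‖ : ℝ) : ℂ)

lemma gp_log_contDiffAt {n : ℕ} {ξ : ℂ} (hξ : ξ ≠ 0) :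
    ContDiffAt ℝ n (fun ξ : ℂ => ((Real.log ‖ξ‖ : ℝ) : ℂ)) ξ := by
  have h1 : ContDiffAt ℝ n (fun ξ : ℂ => Real.log ‖ξ‖) ξ :=
    (contDiffAt_norm ℝ hξ).log (norm_ne_zero_iff.2 hξ)
  exact Complex.ofRealCLM.contDiff.contDiffAt.comp ξ h1

lemma gp_mono_contDiff (p q n : ℕ) : ContDiff ℝ n (fun ξ : ℂ => ξ ^ p * (starRingEnd ℂ ξ) ^ q) := by
  have h1 : ContDiff ℝ n (fun ξ : ℂ => starRingEnd ℂ ξ) := Complex.conjCLE.contDiff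
  exact (contDiff_id.pow p).mul (h1.pow q)

lemma gp_mono_norm (p q : ℕ) (ξ : ℂ) : ‖ξ ^ p * (starRingEnd ℂ ξ) ^ q‖ = ‖ξ‖ ^ (p + q) := by
  rw [norm_mul, norm_pow, norm_pow, RCLike.norm_conj, pow_add]

lemma gpG_cont (p q k : ℕ) (h : p + q = k + 1) : Continuous (gpG p q) := by
  rw [continuous_iff_continuousAt]
  intro ξ
  by_cases hξ : ξ = 0
  · subst hξ
    have h0 : gpG p q 0 = 0 := by simp [gpG]
    unfold ContinuousAt
    rw [h0, tendsto_zero_iff_norm_tendsto_zero]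
    have h1 : Continuous (fun ξ : ℂ => ‖ξ‖ ^ k * |‖ξ‖ * Real.log ‖ξ‖|) := by
      have := Real.continuous_mul_log.comp (continuous_norm (E := ℂ))
      exact (continuous_norm.pow k).mul this.abs
    have h2 := h1.tendsto 0
    simp only [norm_zero, zero_mul, abs_zero, mul_zero] at h2
    refine h2.congr fun ξ => ?_
    unfold gpG
    rw [norm_mul, gp_mono_norm, h, Complex.norm_real, Real.norm_eq_abs, abs_mul, abs_norm]
    ring
  · exact ((gp_mono_contDiff p q 0).continuous.continuousAt).mul (gp_log_contDiffAt (n := 0) hξ).continuousAt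

theorem gpG_contDiff (p q k : ℕ) (h : p + q = k + 1) : ContDiff ℝ k (gpG p q) := by
  obtain ⟨S, hS, hL⟩ := gpL_log
  have e : ∀ ξ, gpM p q ξ = -2 * gpG p q ξ + ξ ^ p * (starRingEnd ℂ ξ) ^ q * S ξ := by
    intro ξ
    by_cases hξ : ξ = 0
    · subst hξ
      have : (0 : ℂ) ^ p * (starRingEnd ℂ 0) ^ q = 0 := by
        rw [← norm_eq_zero, gp_mono_norm, h]; simp
      simp only [gpM, gpG, this]; simp
    · simp only [gpM, gpG, hL ξ hξ]; ring
  have hc : Continuous (gpM p q) := by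
    rw [funext e]
    exact (continuous_const.mul (gpG_cont p q k h)).add
      ((gp_mono_contDiff p q 0).continuous.mul (hS 0).continuous)
  obtain ⟨C, hC⟩ := gpM_decay p q
  have hC' : ∀ t : ℂ, 1 ≤ ‖t‖ → ‖𝓕 (gpM p q) t‖ ≤ C * ‖t‖⁻¹ ^ (k + 3) := by
    intro t ht
    have := hC t ht
    rwa [h] at this
  have hfc := gp_fourier_cont (gpM_int p q)
  have h1 := gp_inv_contDiff hfc k hC'
  rw [hc.fourierInv_fourier_eq (gpM_int p q) (gp_decay_int0 hfc k hC')] at h1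
  have e2 : gpG p q = fun ξ => (-2⁻¹ : ℂ) * (gpM p q ξ - ξ ^ p * (starRingEnd ℂ ξ) ^ q * S ξ) := by
    ext ξ
    rw [e]; ring
  rw [e2]
  exact contDiff_const.mul (h1.sub ((gp_mono_contDiff p q k).mul (hS k)))
end FourierSmooth

section Borel

lemma gp_scale_bound {F : ℂ → ℂ} {j : ℕ} (hF : ContDiff ℝ j F) (hs : HasCompactSupport F) :
    ∃ A : ℝ, 0 ≤ A ∧ ∀ ε : ℝ, 0 < ε → ε ≤ 1 → ∀ k : ℕ, k ≤ j → ∀ x : ℂ,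
      ‖iteratedFDeriv ℝ k (fun x => ε ^ (j + 1) • F (ε⁻¹ • x)) x‖ ≤ ε * A := by
  have h1 : ∀ k : ℕ, ∃ C : ℝ, k ≤ j → ∀ x, ‖iteratedFDeriv ℝ k F x‖ ≤ C := by
    intro k
    by_cases hk : k ≤ j
    · obtain ⟨C, hC⟩ := (hs.iteratedFDeriv (𝕜 := ℝ) k).exists_bound_of_continuous
        (hF.continuous_iteratedFDeriv (by exact_mod_cast hk))
      exact ⟨C, fun _ => hC⟩
    · exact ⟨0, fun h => absurd h hk⟩
  choose C hC using h1
  refine ⟨∑ k ∈ Finset.range (j + 1), |C k|, Finset.sum_nonneg fun _ _ => abs_nonneg _, ?_⟩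
  intro ε hε hε1 k hk x
  have hFk : ContDiff ℝ k F := hF.of_le (by exact_mod_cast hk)
  have hFk' : ContDiff ℝ k (fun x => F (ε⁻¹ • x)) := hFk.comp (contDiff_const_smul _)
  rw [iteratedFDeriv_const_smul_apply' hFk'.contDiffAt, iteratedFDeriv_comp_const_smul _ hFk,
    norm_smul, norm_smul, norm_pow, norm_pow, norm_inv, Real.norm_of_nonneg hε.le, ← mul_assoc]
  have h2 : ‖iteratedFDeriv ℝ k F (ε⁻¹ • x)‖ ≤ ∑ k ∈ Finset.range (j + 1), |C k| :=
    ((hC k hk _).trans (le_abs_self _)).trans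
      (Finset.single_le_sum (f := fun k => |C k|) (fun _ _ => abs_nonneg _) (Finset.mem_range.2 (by omega)))
  have h3 : ε ^ (j + 1) * ε⁻¹ ^ k ≤ ε := by
    have : ε ^ (j + 1) * ε⁻¹ ^ k = ε ^ (j + 1 - k) := by
      rw [inv_pow, ← div_eq_mul_inv, div_eq_iff (by positivity), ← pow_add]
      congr 1
      omega
    rw [this]
    calc ε ^ (j + 1 - k) ≤ ε ^ 1 := pow_le_pow_of_le_one hε.le hε1 (by omega)
      _ = ε := pow_one _
  exact mul_le_mul h3 h2 (norm_nonneg _) hε.le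

/-- cutoff -/
def gpBump : ContDiffBump (0 : ℂ) := ⟨1, 2, one_pos, one_lt_two⟩

/-- complex valued cutoff -/
def gpChi (x : ℂ) : ℂ := ((gpBump x : ℝ) : ℂ)

lemma gpChi_contDiff (n : ℕ) : ContDiff ℝ n gpChi :=
  Complex.ofRealCLM.contDiff.comp gpBump.contDiff

lemma gpChi_supp : HasCompactSupport gpChi :=
  gpBump.hasCompactSupport.comp_left (g := fun r : ℝ => (r : ℂ)) Complex.ofReal_zero

lemma gpChi_one (x : ℂ) (hx : ‖x‖ ≤ 1) : gpChi x = 1 := by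
  unfold gpChi
  rw [gpBump.one_of_mem_closedBall (by simpa [gpBump] using hx)]
  simp

/-- the truncated term -/
def gpT (h : ℂ → ℂ) (ε : ℝ) (x : ℂ) : ℂ := h x * gpChi (ε⁻¹ • x)

lemma gpT_contDiff {h : ℂ → ℂ} (ε : ℝ) {n : ℕ} (hh : ContDiff ℝ n h) : ContDiff ℝ n (gpT h ε) :=
  hh.mul ((gpChi_contDiff n).comp (contDiff_const_smul _))

lemma gpT_exists (h : ℂ → ℂ) (j : ℕ) (hh : ContDiff ℝ j h)
    (hom : ∀ (r : ℝ) (x : ℂ), 0 < r → h (r • x) = r ^ (j + 1) • h x)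
    (hl : ContDiff ℝ j (fun x => h x * ((Real.log ‖x‖ : ℝ) : ℂ))) (δ : ℝ) (hδ : 0 < δ) :
    ∃ ε : ℝ, 0 < ε ∧ (∀ k : ℕ, k ≤ j → ∀ x : ℂ, ‖iteratedFDeriv ℝ k (gpT h ε) x‖ ≤ δ) ∧
      (ContDiff ℝ j (fun x => gpT h ε x * ((Real.log ‖x‖ : ℝ) : ℂ))) ∧
      (∀ k : ℕ, k ≤ j → ∀ x : ℂ,
        ‖iteratedFDeriv ℝ k (fun x => gpT h ε x * ((Real.log ‖x‖ : ℝ) : ℂ)) x‖ ≤ δ) := by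
  have h0 : h 0 = 0 := by
    have := hom 2 0 two_pos
    rw [smul_zero, Complex.real_smul] at this
    have h2 : (1 - ((2 ^ (j + 1) : ℝ) : ℂ)) * h 0 = 0 := by linear_combination this
    rcases mul_eq_zero.1 h2 with h3 | h3
    · exfalso
      have h4 : (1 : ℝ) - 2 ^ (j + 1) = 0 := by exact_mod_cast h3
      have h5 : (1 : ℝ) < 2 ^ (j + 1) := one_lt_pow₀ (by norm_num) (by omega)
      linarith
    · exact h3
  let H : ℂ → ℂ := fun x => h x * gpChi x
  let G : ℂ → ℂ := fun x => (h x * ((Real.log ‖x‖ : ℝ) : ℂ)) * gpChi x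
  have hH : ContDiff ℝ j H := hh.mul (gpChi_contDiff j)
  have hG : ContDiff ℝ j G := hl.mul (gpChi_contDiff j)
  obtain ⟨A, hA0, hA⟩ := gp_scale_bound hH (gpChi_supp.mul_left)
  obtain ⟨B, hB0, hB⟩ := gp_scale_bound hG (gpChi_supp.mul_left)
  have hT : ∀ ε : ℝ, 0 < ε → gpT h ε = fun x => ε ^ (j + 1) • H (ε⁻¹ • x) := by
    intro ε hε
    ext x
    simp only [H, gpT]
    rw [hom _ _ (inv_pos.2 hε), ← smul_mul_assoc, smul_smul, ← mul_pow, mul_inv_cancel₀ hε.ne',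
      one_pow, one_smul]
  have hTl : ∀ ε : ℝ, 0 < ε → (fun x => gpT h ε x * ((Real.log ‖x‖ : ℝ) : ℂ)) =
      fun x => ε ^ (j + 1) • G (ε⁻¹ • x) + Real.log ε • (ε ^ (j + 1) • H (ε⁻¹ • x)) := by
    intro ε hε
    ext x
    rw [← congrFun (hT ε hε) x]
    by_cases hx : x = 0
    · subst hx
      simp [gpT, G, h0]
    · have e1 : Real.log ‖ε⁻¹ • x‖ = Real.log ‖x‖ - Real.log ε := by
        rw [norm_smul, norm_inv, Real.norm_of_nonneg hε.le,
          Real.log_mul (inv_ne_zero hε.ne') (norm_ne_zero_iff.2 hx), Real.log_inv]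
        ring
      simp only [G, gpT, e1]
      rw [hom _ _ (inv_pos.2 hε)]
      have e2 : ε ^ (j + 1) • (ε⁻¹ ^ (j + 1) • h x * ((Real.log ‖x‖ - Real.log ε : ℝ) : ℂ) * gpChi (ε⁻¹ • x)) =
          h x * ((Real.log ‖x‖ - Real.log ε : ℝ) : ℂ) * gpChi (ε⁻¹ • x) := by
        rw [← smul_mul_assoc, ← smul_mul_assoc, smul_smul, ← mul_pow, mul_inv_cancel₀ hε.ne',
          one_pow, one_smul]
      rw [e2]
      generalize gpChi (ε⁻¹ • x) = X
      rw [Complex.real_smul]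
      push_cast
      ring
  -- choose ε
  have hlim : Tendsto (fun ε : ℝ => ε * A + (ε * B + |ε * Real.log ε| * A)) (nhdsWithin 0 (Set.Ioi 0)) (nhds 0) := by
    have hc : Continuous (fun ε : ℝ => ε * A + (ε * B + |ε * Real.log ε| * A)) := by
      have := Real.continuous_mul_log
      fun_prop
    have := (hc.tendsto 0).mono_left (nhdsWithin_le_nhds (s := Set.Ioi 0))
    simpa using this
  have hev : ∀ᶠ ε in nhdsWithin (0 : ℝ) (Set.Ioi 0), 0 < ε ∧ ε < 1 ∧
      ε * A + (ε * B + |ε * Real.log ε| * A) < δ := by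
    filter_upwards [self_mem_nhdsWithin, nhdsWithin_le_nhds (Iio_mem_nhds (one_pos)), hlim.eventually (Iio_mem_nhds hδ)] with ε h1 h2 h3
    exact ⟨h1, h2, h3⟩
  obtain ⟨ε, hε, hε1, hεδ⟩ := hev.exists
  have hGs : ContDiff ℝ j (fun x => ε ^ (j + 1) • G (ε⁻¹ • x)) :=
    (hG.comp (contDiff_const_smul _)).const_smul _
  have hHs : ContDiff ℝ j (fun x => ε ^ (j + 1) • H (ε⁻¹ • x)) :=
    (hH.comp (contDiff_const_smul _)).const_smul _
  have hp1 : 0 ≤ ε * A := by positivity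
  have hp2 : 0 ≤ ε * B := by positivity
  have hp3 : 0 ≤ |ε * Real.log ε| * A := by positivity
  refine ⟨ε, hε, fun k hk x => ?_, ?_, fun k hk x => ?_⟩
  · rw [hT ε hε]
    have := hA ε hε hε1.le k hk x
    linarith
  · rw [hTl ε hε]
    exact hGs.add (hHs.const_smul _)
  · rw [hTl ε hε]
    have hGk := (hGs.of_le (show (k : WithTop ℕ∞) ≤ j by exact_mod_cast hk)).contDiffAt (x := x)
    have hHk := (hHs.of_le (show (k : WithTop ℕ∞) ≤ j by exact_mod_cast hk)).contDiffAt (x := x)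
    have e := iteratedFDeriv_add_apply (x := x) hGk (hHk.const_smul (Real.log ε))
    have e' := iteratedFDeriv_const_smul_apply' (a := Real.log ε) hHk
    have b1 := hA ε hε hε1.le k hk x
    have b2 := hB ε hε hε1.le k hk x
    have b3 : ‖Real.log ε • iteratedFDeriv ℝ k (fun x => ε ^ (j + 1) • H (ε⁻¹ • x)) x‖ ≤ |ε * Real.log ε| * A := by
      rw [norm_smul, abs_mul, abs_of_pos hε, Real.norm_eq_abs]
      calc _ ≤ |Real.log ε| * (ε * A) := by gcongr
        _ = _ := by ring
    calc _ = ‖iteratedFDeriv ℝ k (fun x => ε ^ (j + 1) • G (ε⁻¹ • x)) x +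
        Real.log ε • iteratedFDeriv ℝ k (fun x => ε ^ (j + 1) • H (ε⁻¹ • x)) x‖ := by
          rw [← e']; exact congrArg norm e
      _ ≤ _ := norm_add_le _ _
      _ ≤ δ := by linarith

lemma gpT_sub_log {h : ℂ → ℂ} {n : ℕ} (hh : ContDiff ℝ n h) (ε : ℝ) (hε : 0 < ε) :
    ContDiff ℝ n (fun x => (gpT h ε x - h x) * ((Real.log ‖x‖ : ℝ) : ℂ)) := by
  rw [contDiff_iff_contDiffAt]
  intro x
  by_cases hx : x = 0
  · subst hx
    have : (fun x => (gpT h ε x - h x) * ((Real.log ‖x‖ : ℝ) : ℂ)) =ᶠ[nhds 0] fun _ => 0 := by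
      filter_upwards [Metric.ball_mem_nhds (0 : ℂ) hε] with x hx
      have hx' : ‖x‖ < ε := by simpa using hx
      have : gpChi (ε⁻¹ • x) = 1 := by
        apply gpChi_one
        rw [norm_smul, norm_inv, Real.norm_of_nonneg hε.le, inv_mul_le_iff₀ hε]
        linarith
      simp only [gpT, this]
      ring
    exact contDiffAt_const.congr_of_eventuallyEq this
  · exact (((gpT_contDiff ε hh).sub hh).contDiffAt).mul (gp_log_contDiffAt hx)

theorem gp_borel (h : ℕ → ℂ → ℂ) (hh : ∀ i n : ℕ, ContDiff ℝ n (h i))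
    (hom : ∀ (i : ℕ) (r : ℝ) (x : ℂ), 0 < r → h i (r • x) = r ^ i • h i x)
    (hl : ∀ j : ℕ, ContDiff ℝ j (fun x => h (j + 1) x * ((Real.log ‖x‖ : ℝ) : ℂ))) :
    ∃ C₁ : ℂ → ℂ, (∀ n : ℕ, ContDiff ℝ n C₁) ∧ ∀ k : ℕ,
      ContDiff ℝ k (fun x => (C₁ x - ∑ i ∈ Finset.range (k + 1), h i x) * ((Real.log ‖x‖ : ℝ) : ℂ)) := by
  have hch : ∀ i : ℕ, ∃ ε : ℝ, 0 < ε ∧ ∀ j, i = j + 1 →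
      (∀ k : ℕ, k ≤ j → ∀ x : ℂ, ‖iteratedFDeriv ℝ k (gpT (h i) ε) x‖ ≤ (1 / 2) ^ i) ∧
      (ContDiff ℝ j (fun x => gpT (h i) ε x * ((Real.log ‖x‖ : ℝ) : ℂ))) ∧
      (∀ k : ℕ, k ≤ j → ∀ x : ℂ,
        ‖iteratedFDeriv ℝ k (fun x => gpT (h i) ε x * ((Real.log ‖x‖ : ℝ) : ℂ)) x‖ ≤ (1 / 2) ^ i) := by
    intro i
    rcases i with _ | j
    · exact ⟨1, one_pos, fun j hj => by omega⟩
    · obtain ⟨ε, h1, h2⟩ := gpT_exists (h (j + 1)) j (hh _ _) (hom _) (hl j) ((1 / 2) ^ (j + 1)) (by positivity)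
      refine ⟨ε, h1, fun j' hj' => ?_⟩
      obtain rfl : j = j' := by omega
      exact h2
  choose ε hε hb using hch
  let T : ℕ → ℂ → ℂ := fun i => gpT (h i) (ε i)
  have hT : ∀ i n : ℕ, ContDiff ℝ n (T i) := fun i n => gpT_contDiff _ (hh i n)
  have hgeo : Summable (fun i : ℕ => ((1 / 2 : ℝ)) ^ i) := summable_geometric_two
  have hTb : ∀ k i : ℕ, k < i → ∀ x, ‖iteratedFDeriv ℝ k (T i) x‖ ≤ (1 / 2) ^ i := by
    intro k i hki x
    obtain ⟨j, rfl⟩ : ∃ j, i = j + 1 := ⟨i - 1, by omega⟩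
    exact (hb (j + 1) j rfl).1 k (by omega) x
  have hsum : ∀ x, Summable (fun i => T i x) := by
    intro x
    refine Summable.of_norm_bounded_eventually_nat hgeo ?_
    filter_upwards [eventually_gt_atTop 0] with i hi
    simpa using hTb 0 i hi x
  refine ⟨fun x => ∑' i, T i x, fun n => ?_, fun k => ?_⟩
  · have := contDiff_tsum_of_eventually (𝕜 := ℝ) (f := T) (N := (n : ℕ∞)) (v := fun _ i => ((1 / 2 : ℝ)) ^ i)
      (fun i => hT i n) (fun _ _ => hgeo) (fun k _ => by
        rw [Nat.cofinite_eq_atTop]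
        filter_upwards [eventually_gt_atTop k] with i hi
        exact hTb k i hi)
    exact this
  · have htail : ContDiff ℝ k (fun x => ∑' i, T (i + (k + 1)) x * ((Real.log ‖x‖ : ℝ) : ℂ)) := by
      have := contDiff_tsum (𝕜 := ℝ) (f := fun i x => T (i + (k + 1)) x * ((Real.log ‖x‖ : ℝ) : ℂ))
        (N := (k : ℕ∞)) (v := fun _ i => ((1 / 2 : ℝ)) ^ (i + (k + 1)))
        (fun i => ((hb (i + (k + 1)) (i + k) rfl).2.1).of_le (by norm_cast; omega))
        (fun _ _ => (summable_nat_add_iff (k + 1)).2 hgeo)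
        (fun l i x hl => (hb (i + (k + 1)) (i + k) rfl).2.2 l (by
          have : l ≤ k := by exact_mod_cast hl
          omega) x)
      exact this
    have hfin : ContDiff ℝ k (fun x => ∑ i ∈ Finset.range (k + 1), (T i x - h i x) * ((Real.log ‖x‖ : ℝ) : ℂ)) :=
      ContDiff.sum fun i _ => gpT_sub_log (hh i k) (ε i) (hε i)
    have e : (fun x => ((∑' i, T i x) - ∑ i ∈ Finset.range (k + 1), h i x) * ((Real.log ‖x‖ : ℝ) : ℂ)) =
        fun x => (∑ i ∈ Finset.range (k + 1), (T i x - h i x) * ((Real.log ‖x‖ : ℝ) : ℂ)) +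
          ∑' i, T (i + (k + 1)) x * ((Real.log ‖x‖ : ℝ) : ℂ) := by
      ext x
      rw [tsum_mul_right, ← Finset.sum_mul, ← add_mul, ← (hsum x).sum_add_tsum_nat_add (k + 1),
        Finset.sum_sub_distrib]
      ring
    rw [e]
    exact hfin.add htail
end Borel

section Pairing
open scoped FourierTransform RealInnerProductSpace

lemma gp_fourier_flip {f g : ℂ → ℂ} (hf : Integrable f) (hg : Integrable g) :
    ∫ ξ, 𝓕 f ξ * g ξ = ∫ x, f x * 𝓕 g x := by
  simpa using! VectorFourier.integral_bilin_fourierIntegral_eq_flip (.mul ℂ ℂ) (L := innerₗ ℂ)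
    Real.continuous_fourierChar continuous_inner hf hg

lemma gp_fourier_flip_inv (φ : SchwartzMap ℂ ℂ) {R : ℂ → ℂ} (hR : Integrable R) :
    ∫ ξ, φ ξ * 𝓕⁻ R ξ = ∫ x, 𝓕⁻ (φ : ℂ → ℂ) x * R x := by
  have h1 := gp_fourier_flip (f := fun x => φ (-x)) (g := R) φ.integrable.comp_neg hR
  rw [Real.fourierInv_eq_fourier_comp_neg (φ : ℂ → ℂ), h1,
    ← integral_neg_eq_self (fun x => φ (-x) * 𝓕 R x)]
  simp [Real.fourierInv_eq_fourier_neg]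

lemma gp_pair {d : ℕ} (Φ : SchwartzMap (Fin d → ℂ) ℂ) (φ : SchwartzMap ℂ ℂ) :
    ∫ z : Fin d → ℂ, φ (splitQC d z) * Φ z = ∫ t, 𝓕⁻ (φ : ℂ → ℂ) t * gpA Φ t := by
  have hq := gp_splitQC_cont d
  set G : SchwartzMap ℂ ℂ := 𝓕⁻ φ with hG
  have hGc : 𝓕⁻ (φ : ℂ → ℂ) = (G : ℂ → ℂ) := by rw [hG, SchwartzMap.fourierInv_coe]
  have hφ : φ = 𝓕 G := by rw [hG, FourierTransform.fourier_fourierInv_eq]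
  rw [hGc]
  have e1 : ∀ z, φ (splitQC d z) * Φ z =
      ∫ t, G t * (𝐞 (-⟪splitQC d z, t⟫) • Φ z) := by
    intro z
    conv_lhs => rw [hφ, SchwartzMap.fourier_coe, Real.fourier_eq, ← integral_mul_const]
    refine integral_congr_ae (Eventually.of_forall fun t => ?_)
    simp only [Circle.smul_def, smul_eq_mul]
    rw [real_inner_comm]
    ring
  have e2 : ∀ t, G t * gpA Φ t = ∫ z, G t * (𝐞 (-⟪splitQC d z, t⟫) • Φ z) := by
    intro t
    rw [integral_const_mul, gpA]
  simp_rw [e1, e2]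
  rw [integral_integral_swap]
  have h := (Φ.integrable (μ := volume)).norm.mul_prod (G.integrable (μ := volume)).norm
  refine h.mono' ?_ (Eventually.of_forall fun p => ?_)
  · apply Continuous.aestronglyMeasurable
    have h1 := Φ.continuous
    have h2 := G.continuous
    simp only [Function.uncurry, Circle.smul_def]
    fun_prop
  · simp only [Function.uncurry, norm_mul, Circle.norm_smul]
    rw [mul_comm]

lemma gp_pow_mono {t : ℂ} (ht : 1 ≤ ‖t‖) {a b : ℕ} (hab : a ≤ b) : ‖t‖⁻¹ ^ b ≤ ‖t‖⁻¹ ^ a :=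
  pow_le_pow_of_le_one (by positivity) (inv_le_one_of_one_le₀ ht) hab

theorem gp_main (μ : ℕ) (Φ : SchwartzMap (Fin (2 * (μ + 1)) → ℂ) ℂ) :
    ∃ b : ℕ → ℕ → ℂ, ∀ k : ℕ, ∃ E : ℂ → ℂ, ContDiff ℝ k E ∧ ∀ φ : SchwartzMap ℂ ℂ,
      ∫ z, φ (splitQC _ z) * Φ z = ∫ ξ, φ ξ * (E ξ +
        ∑ n ∈ Finset.range (k + 1), ∑ pq ∈ Finset.HasAntidiagonal.antidiagonal n,
          b pq.1 pq.2 * gpM (pq.2 + μ) (pq.1 + μ) ξ) := by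
  obtain ⟨a, ha⟩ := gpA_expand (μ + 1) Φ
  choose c hc0 hc using gpM_asymp
  let b : ℕ → ℕ → ℂ := fun p q => a p q / c (q + μ) (p + μ)
  refine ⟨b, fun k => ?_⟩
  let B : ℂ → ℂ := fun t => ∑ n ∈ Finset.range (k + 1), ∑ pq ∈ Finset.HasAntidiagonal.antidiagonal n,
          b pq.1 pq.2 * 𝓕 (gpM (pq.2 + μ) (pq.1 + μ)) t
  let R : ℂ → ℂ := fun t => gpA Φ t - B t
  have hBc : Continuous B := continuous_finsetSum _ fun n _ => continuous_finsetSum _ fun pq _ =>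
    continuous_const.mul (gp_fourier_cont (gpM_int _ _))
  have hRc : Continuous R := (gpA_cont Φ).sub hBc
  obtain ⟨C0, hC0⟩ := ha (k + 1)
  choose D hD using fun p q => hc p q (k + 3)
  have hdec : ∀ t : ℂ, 1 ≤ ‖t‖ → ‖R t‖ ≤ (|C0| + ∑ n ∈ Finset.range (k + 1), ∑ pq ∈ Finset.HasAntidiagonal.antidiagonal n,
      ‖b pq.1 pq.2‖ * D (pq.2 + μ) (pq.1 + μ)) * ‖t‖⁻¹ ^ (k + 3) := by
    intro t ht
    have ht0 : t ≠ 0 := by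
      rintro rfl
      simp at ht
      linarith
    have h1 := hC0 t ht0
    set A' := ∑ n ∈ Finset.range (k + 1), ∑ pq ∈ Finset.HasAntidiagonal.antidiagonal n,
        a pq.1 pq.2 * (t⁻¹ ^ (pq.1 + (μ + 1)) * (starRingEnd ℂ t⁻¹) ^ (pq.2 + (μ + 1))) with hA'
    have h2 : ‖A' - B t‖ ≤ (∑ n ∈ Finset.range (k + 1), ∑ pq ∈ Finset.HasAntidiagonal.antidiagonal n,
      ‖b pq.1 pq.2‖ * D (pq.2 + μ) (pq.1 + μ)) * ‖t‖⁻¹ ^ (k + 3) := by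
      simp only [hA', B]
      rw [← Finset.sum_sub_distrib, Finset.sum_mul]
      refine (norm_sum_le _ _).trans (Finset.sum_le_sum fun n _ => ?_)
      rw [← Finset.sum_sub_distrib, Finset.sum_mul]
      refine (norm_sum_le _ _).trans (Finset.sum_le_sum fun pq _ => ?_)
      have h3 := hD (pq.2 + μ) (pq.1 + μ) t ht
      have e : a pq.1 pq.2 * (t⁻¹ ^ (pq.1 + (μ + 1)) * (starRingEnd ℂ t⁻¹) ^ (pq.2 + (μ + 1))) -
          b pq.1 pq.2 * 𝓕 (gpM (pq.2 + μ) (pq.1 + μ)) t = - (b pq.1 pq.2 * (𝓕 (gpM (pq.2 + μ) (pq.1 + μ)) t -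
          c (pq.2 + μ) (pq.1 + μ) * (t⁻¹ ^ (pq.1 + μ + 1) * (starRingEnd ℂ t⁻¹) ^ (pq.2 + μ + 1)))) := by
        have : a pq.1 pq.2 = b pq.1 pq.2 * c (pq.2 + μ) (pq.1 + μ) := by
          simp only [b]
          rw [div_mul_cancel₀ _ (hc0 _ _)]
        rw [this]
        ring
      rw [e, norm_neg, norm_mul, mul_assoc]
      gcongr
    have h4 : ‖gpA Φ t - A'‖ ≤ |C0| * ‖t‖⁻¹ ^ (k + 3) := by
      refine h1.trans ?_
      calc C0 * ‖t‖⁻¹ ^ (k + 1 + 2 * (μ + 1)) ≤ |C0| * ‖t‖⁻¹ ^ (k + 1 + 2 * (μ + 1)) := by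
            gcongr
            exact le_abs_self _
        _ ≤ _ := by
            gcongr ?_ * ?_
            exact gp_pow_mono ht (by omega)
    have e : R t = (gpA Φ t - A') + (A' - B t) := by simp only [R]; ring
    rw [e, add_mul]
    exact (norm_add_le _ _).trans (add_le_add h4 h2)
  have hRi : Integrable R := gp_decay_int0 hRc k hdec
  refine ⟨𝓕⁻ R, gp_inv_contDiff hRc k hdec, fun φ => ?_⟩
  set G : SchwartzMap ℂ ℂ := 𝓕⁻ φ with hG
  have hGc : 𝓕⁻ (φ : ℂ → ℂ) = (G : ℂ → ℂ) := by rw [hG, SchwartzMap.fourierInv_coe]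
  have hφ : (φ : ℂ → ℂ) = 𝓕 (G : ℂ → ℂ) := by
    rw [← SchwartzMap.fourier_coe, hG, FourierTransform.fourier_fourierInv_eq]
  have hGb : ∃ K, ∀ x, ‖G x‖ ≤ K := ⟨_, fun x => SchwartzMap.norm_le_seminorm ℝ G x⟩
  have hφb : ∃ K, ∀ x, ‖φ x‖ ≤ K := ⟨_, fun x => SchwartzMap.norm_le_seminorm ℝ φ x⟩
  have hmul : ∀ {ψ : SchwartzMap ℂ ℂ} {f : ℂ → ℂ}, Integrable f → Integrable (fun x => ψ x * f x) := by
    intro ψ f hf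
    exact hf.bdd_mul ψ.continuous.aestronglyMeasurable
      (Eventually.of_forall fun x => SchwartzMap.norm_le_seminorm ℝ ψ x)
  have hmulc : ∀ {ψ : SchwartzMap ℂ ℂ} {f : ℂ → ℂ}, Continuous f → (∃ K, ∀ x, ‖f x‖ ≤ K) →
      Integrable (fun x => ψ x * f x) := by
    rintro ψ f hf ⟨K, hK⟩
    have := (ψ.integrable (μ := volume)).bdd_mul (f := f) hf.aestronglyMeasurable (Eventually.of_forall hK)
    simpa only [mul_comm] using this
  have hfb : ∀ {f : ℂ → ℂ}, Integrable f → ∃ K, ∀ x, ‖𝓕 f x‖ ≤ K := by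
    intro f hf
    refine ⟨∫ v, ‖f v‖, fun x => ?_⟩
    rw [Real.fourier_eq]
    refine (norm_integral_le_integral_norm _).trans (le_of_eq ?_)
    simp only [Circle.norm_smul]
  rw [gp_pair, hGc]
  have e1 : ∀ t, G t * gpA Φ t = G t * R t + ∑ n ∈ Finset.range (k + 1),
      ∑ pq ∈ Finset.HasAntidiagonal.antidiagonal n, b pq.1 pq.2 * (G t * 𝓕 (gpM (pq.2 + μ) (pq.1 + μ)) t) := by
    intro t
    have : ∑ n ∈ Finset.range (k + 1), ∑ pq ∈ Finset.HasAntidiagonal.antidiagonal n,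
        b pq.1 pq.2 * (G t * 𝓕 (gpM (pq.2 + μ) (pq.1 + μ)) t) = G t * B t := by
      simp only [B, Finset.mul_sum]
      refine Finset.sum_congr rfl fun n _ => Finset.sum_congr rfl fun pq _ => by ring
    rw [this]
    simp only [R]
    ring
  have e2 : ∀ ξ, φ ξ * (𝓕⁻ R ξ + ∑ n ∈ Finset.range (k + 1), ∑ pq ∈ Finset.HasAntidiagonal.antidiagonal n,
          b pq.1 pq.2 * gpM (pq.2 + μ) (pq.1 + μ) ξ) = φ ξ * 𝓕⁻ R ξ + ∑ n ∈ Finset.range (k + 1),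
      ∑ pq ∈ Finset.HasAntidiagonal.antidiagonal n, b pq.1 pq.2 * (φ ξ * gpM (pq.2 + μ) (pq.1 + μ) ξ) := by
    intro t
    rw [mul_add]
    simp only [Finset.mul_sum]
    congr 1
    refine Finset.sum_congr rfl fun n _ => Finset.sum_congr rfl fun pq _ => by ring
  simp_rw [e1, e2]
  have i1 : ∀ p q : ℕ, Integrable (fun t => G t * 𝓕 (gpM p q) t) := fun p q =>
    hmulc (gp_fourier_cont (gpM_int _ _)) (hfb (gpM_int _ _))
  have i2 : ∀ p q : ℕ, Integrable (fun t => φ t * gpM p q t) := fun p q => hmul (gpM_int _ _)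
  have i3 : Integrable (fun t => φ t * 𝓕⁻ R t) := by
    apply hmulc ((gp_inv_contDiff hRc k hdec).continuous)
    obtain ⟨K, hK⟩ := hfb hRi
    exact ⟨K, fun x => by rw [Real.fourierInv_eq_fourier_neg]; exact hK _⟩
  rw [integral_add (hmul hRi) (integrable_finsetSum _ fun n _ => integrable_finsetSum _ fun pq _ =>
      (i1 _ _).const_mul _),
    integral_add i3 (integrable_finsetSum _ fun n _ => integrable_finsetSum _ fun pq _ =>
      (i2 _ _).const_mul _), gp_fourier_flip_inv φ hRi, hGc]
  congr 1
  rw [integral_finsetSum _ fun n _ => integrable_finsetSum _ fun pq _ => (i1 _ _).const_mul _,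
    integral_finsetSum _ fun n _ => integrable_finsetSum _ fun pq _ => (i2 _ _).const_mul _]
  refine Finset.sum_congr rfl fun n _ => ?_
  rw [integral_finsetSum _ fun pq _ => (i1 _ _).const_mul _,
    integral_finsetSum _ fun pq _ => (i2 _ _).const_mul _]
  refine Finset.sum_congr rfl fun pq _ => ?_
  rw [integral_const_mul, integral_const_mul, hφ, gp_fourier_flip G.integrable (gpM_int _ _)]

end Pairing

section Assembly
open scoped FourierTransform RealInnerProductSpace ContDiff

/-- the germ -/
def gpF (μ : ℕ) (C₀ C₁ : ℂ → ℂ) (ξ : ℂ) : ℂ :=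
  C₀ ξ + C₁ ξ * ((‖ξ‖ ^ (2 * μ) : ℝ) : ℂ) * ((Real.log ‖ξ‖ : ℝ) : ℂ)

theorem gp_germ (μ : ℕ) (Φ : SchwartzMap (Fin (2 * (μ + 1)) → ℂ) ℂ) :
    ∃ C₀ C₁ : ℂ → ℂ, (∀ n : ℕ, ContDiff ℝ n C₀) ∧ (∀ n : ℕ, ContDiff ℝ n C₁) ∧
      LocallyIntegrable (gpF μ C₀ C₁) ∧ ∀ φ : SchwartzMap ℂ ℂ,
        ∫ z, φ (splitQC _ z) * Φ z = ∫ ξ, φ ξ * gpF μ C₀ C₁ ξ := by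
  obtain ⟨b, hb⟩ := gp_main μ Φ
  obtain ⟨S, hS, hL⟩ := gpL_log
  choose E hE hEφ using hb
  let h : ℕ → ℂ → ℂ := fun n ξ => ∑ pq ∈ Finset.HasAntidiagonal.antidiagonal n,
    (-2 * b pq.1 pq.2) * (ξ ^ pq.2 * (starRingEnd ℂ ξ) ^ pq.1)
  have hh : ∀ i n : ℕ, ContDiff ℝ n (h i) := fun i n =>
    ContDiff.sum fun pq _ => contDiff_const.mul (gp_mono_contDiff _ _ n)
  have hom : ∀ (i : ℕ) (r : ℝ) (x : ℂ), 0 < r → h i (r • x) = r ^ i • h i x := by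
    intro i r x _
    simp only [h, Finset.smul_sum]
    refine Finset.sum_congr rfl fun pq hpq => ?_
    rw [Finset.HasAntidiagonal.mem_antidiagonal] at hpq
    rw [Complex.real_smul, Complex.real_smul, map_mul, Complex.conj_ofReal, ← hpq]
    push_cast
    ring
  have hl : ∀ j : ℕ, ContDiff ℝ j (fun x => h (j + 1) x * ((Real.log ‖x‖ : ℝ) : ℂ)) := by
    intro j
    have e : (fun x => h (j + 1) x * ((Real.log ‖x‖ : ℝ) : ℂ)) = fun x =>
        ∑ pq ∈ Finset.HasAntidiagonal.antidiagonal (j + 1), (-2 * b pq.1 pq.2) * gpG pq.2 pq.1 x := by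
      ext x
      simp only [h, gpG, Finset.sum_mul]
      refine Finset.sum_congr rfl fun pq hpq => by ring
    rw [e]
    refine ContDiff.sum fun pq hpq => contDiff_const.mul (gpG_contDiff _ _ j ?_)
    rw [Finset.HasAntidiagonal.mem_antidiagonal] at hpq
    omega
  obtain ⟨C₁, hC₁, hB⟩ := gp_borel h hh hom hl
  let P : ℕ → ℂ → ℂ := fun k ξ => ∑ n ∈ Finset.range (k + 1),
    ∑ pq ∈ Finset.HasAntidiagonal.antidiagonal n, b pq.1 pq.2 * (ξ ^ pq.2 * (starRingEnd ℂ ξ) ^ pq.1)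
  have hP : ∀ k n : ℕ, ContDiff ℝ n (P k) := fun k n => ContDiff.sum fun i _ =>
    ContDiff.sum fun pq _ => contDiff_const.mul (gp_mono_contDiff _ _ n)
  have hPh : ∀ k ξ, ∑ i ∈ Finset.range (k + 1), h i ξ = -2 * P k ξ := by
    intro k ξ
    simp only [h, P, Finset.mul_sum]
    refine Finset.sum_congr rfl fun n _ => Finset.sum_congr rfl fun pq _ => by ring
  let f : ℕ → ℂ → ℂ := fun k ξ => E k ξ +
        ∑ n ∈ Finset.range (k + 1), ∑ pq ∈ Finset.HasAntidiagonal.antidiagonal n,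
          b pq.1 pq.2 * gpM (pq.2 + μ) (pq.1 + μ) ξ
  have hfP : ∀ k ξ, f k ξ = E k ξ + P k ξ * (ξ ^ μ * (starRingEnd ℂ ξ) ^ μ) * gpL ξ := by
    intro k ξ
    simp only [f, P, Finset.sum_mul, gpM]
    congr 1
    refine Finset.sum_congr rfl fun n _ => Finset.sum_congr rfl fun pq _ => by ring
  have hW : ∀ ξ : ℂ, ξ ^ μ * (starRingEnd ℂ ξ) ^ μ = ((‖ξ‖ ^ (2 * μ) : ℝ) : ℂ) := by
    intro ξ
    rw [← mul_pow, Complex.mul_conj, Complex.normSq_eq_norm_sq, pow_mul]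
    push_cast
    rfl
  let c : ℕ → ℂ → ℂ := fun k ξ => E k ξ + P k ξ * (ξ ^ μ * (starRingEnd ℂ ξ) ^ μ) * S ξ -
    (C₁ ξ - ∑ i ∈ Finset.range (k + 1), h i ξ) * ((Real.log ‖ξ‖ : ℝ) : ℂ) * (ξ ^ μ * (starRingEnd ℂ ξ) ^ μ)
  have hc : ∀ k : ℕ, ContDiff ℝ k (c k) := fun k =>
    ((hE k).add (((hP k k).mul (gp_mono_contDiff μ μ k)).mul (hS k))).sub
      ((hB k).mul (gp_mono_contDiff μ μ k))
  have hfc : ∀ k ξ, ξ ≠ 0 → f k ξ = gpF μ (c k) C₁ ξ := by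
    intro k ξ hξ
    rw [hfP, hL ξ hξ, gpF, ← hW]
    simp only [c, hPh]
    ring
  have hfc' : ∀ k, f k =ᵐ[volume] gpF μ (c k) C₁ := by
    intro k
    have : ∀ᵐ ξ : ℂ, ξ ≠ 0 := by
      simp [ae_iff]
    filter_upwards [this] with ξ hξ using hfc k ξ hξ
  have hfl : ∀ k, LocallyIntegrable (f k) := fun k => by
    refine (hE k).continuous.locallyIntegrable.add (Integrable.locallyIntegrable ?_)
    exact integrable_finsetSum _ fun n _ => integrable_finsetSum _ fun pq _ => (gpM_int _ _).const_mul _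
  have hff : ∀ k, f k =ᵐ[volume] f 0 := by
    intro k
    refine ae_eq_of_integral_contDiff_smul_eq (hfl k) (hfl 0) fun g hg hgs => ?_
    let φ : SchwartzMap ℂ ℂ := HasCompactSupport.toSchwartzMap (f := fun x => ((g x : ℝ) : ℂ))
      (hgs.comp_left (g := fun r : ℝ => (r : ℂ)) Complex.ofReal_zero)
      (Complex.ofRealCLM.contDiff.comp hg)
    have h1 := (hEφ k φ).symm.trans (hEφ 0 φ)
    have h2 : ∀ ξ, φ ξ = ((g ξ : ℝ) : ℂ) := fun _ => rfl
    simp only [h2] at h1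
    simp only [Complex.real_smul]
    exact h1
  have hcc : ∀ k, c k = c 0 := by
    intro k
    refine ((hc k).continuous.ae_eq_iff_eq volume (hc 0).continuous).1 ?_
    filter_upwards [hff k, hfc' k, hfc' 0] with ξ h1 h2 h3
    rw [h2, h3] at h1
    simpa [gpF] using h1
  refine ⟨c 0, C₁, fun n => hcc n ▸ hc n, hC₁, ?_, fun φ => ?_⟩
  · intro x
    obtain ⟨U, hU, hi⟩ := hfl 0 x
    exact ⟨U, hU, hi.congr (ae_restrict_of_ae (hfc' 0))⟩
  · rw [hEφ 0 φ]
    refine integral_congr_ae ?_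
    filter_upwards [hfc' 0] with ξ h1
    rw [← h1]

lemma gp_extend {d : ℕ} (Φ : SchwartzMap (Fin d → ℂ) ℂ) {F : ℂ → ℂ} (hF : LocallyIntegrable F)
    (hφ : ∀ φ : SchwartzMap ℂ ℂ, ∫ z, φ (splitQC d z) * Φ z = ∫ ξ, φ ξ * F ξ)
    {g : ℂ → ℂ} (hg : Continuous g) (hgs : HasCompactSupport g) :
    ∫ z, g (splitQC d z) * Φ z = ∫ ξ, g ξ * F ξ := by
  have hq := gp_splitQC_cont d
  obtain ⟨r, hr0, hr⟩ : ∃ r : ℝ, 0 < r ∧ tsupport g ⊆ Metric.closedBall 0 r := by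
    obtain ⟨r, hr⟩ := hgs.isCompact.isBounded.subset_closedBall 0
    exact ⟨max r 1, by positivity, hr.trans (Metric.closedBall_subset_closedBall (le_max_left _ _))⟩
  let χ : ContDiffBump (0 : ℂ) := ⟨r, 2 * r, hr0, by linarith⟩
  let K : Set ℂ := Metric.closedBall 0 (2 * r)
  have hFK : IntegrableOn F K := hF.integrableOn_isCompact (isCompact_closedBall _ _)
  have hχs : HasCompactSupport (fun x => ((χ x : ℝ) : ℂ)) :=
    χ.hasCompactSupport.comp_left (g := fun r : ℝ => (r : ℂ)) Complex.ofReal_zero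
  have hχg : ∀ x, ((χ x : ℝ) : ℂ) * g x = g x := by
    intro x
    by_cases hx : x ∈ tsupport g
    · rw [χ.one_of_mem_closedBall (hr hx)]; simp
    · rw [image_eq_zero_of_notMem_tsupport hx, mul_zero]
  have key : ∀ ε : ℝ, 0 < ε → ‖(∫ z, g (splitQC d z) * Φ z) - ∫ ξ, g ξ * F ξ‖ ≤
      ε * ((∫ z, ‖Φ z‖) + ∫ ξ in K, ‖F ξ‖) := by
    intro ε hε
    obtain ⟨u, hu, hug⟩ := (hgs.uniformContinuous_of_continuous hg).exists_contDiff_dist_le hε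
    have hφs : HasCompactSupport (fun x => ((χ x : ℝ) : ℂ) * u x) := hχs.mul_right
    have hφc : ContDiff ℝ ∞ (fun x => ((χ x : ℝ) : ℂ) * u x) :=
      (Complex.ofRealCLM.contDiff.comp χ.contDiff).mul hu
    let φ : SchwartzMap ℂ ℂ := hφs.toSchwartzMap hφc
    have hφe : ∀ x, φ x = ((χ x : ℝ) : ℂ) * u x := fun _ => rfl
    have hd1 : ∀ x, ‖g x - φ x‖ ≤ ε := by
      intro x
      rw [hφe]
      conv_lhs => rw [← hχg x]
      rw [← mul_sub, norm_mul, Complex.norm_real, Real.norm_of_nonneg χ.nonneg, ← dist_eq_norm, dist_comm]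
      calc χ x * dist (u x) (g x) ≤ 1 * ε := by
            gcongr
            · exact χ.le_one
            · exact (hug x).le
        _ = ε := one_mul _
    have hd2 : ∀ x, x ∉ K → g x - φ x = 0 := by
      intro x hx
      have hχ0 : χ x = 0 := χ.zero_of_le_dist (by
        simp only [K, Metric.mem_closedBall, not_le] at hx
        exact hx.le)
      rw [hφe]
      conv_lhs => rw [← hχg x]
      simp [hχ0]
    have i1 : Integrable (fun z => g (splitQC d z) * Φ z) := by
      obtain ⟨B, hB⟩ := hgs.exists_bound_of_continuous hg
      exact Φ.integrable.bdd_mul (hg.comp hq).aestronglyMeasurable (Eventually.of_forall fun z => hB _)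
    have i2 : Integrable (fun z => φ (splitQC d z) * Φ z) :=
      Φ.integrable.bdd_mul (φ.continuous.comp hq).aestronglyMeasurable
        (Eventually.of_forall fun z => SchwartzMap.norm_le_seminorm ℝ φ _)
    have i3 : Integrable (fun ξ => g ξ * F ξ) := by
      have := hF.integrable_smul_left_of_hasCompactSupport hg hgs
      simpa using this
    have i4 : Integrable (fun ξ => φ ξ * F ξ) := by
      have := hF.integrable_smul_left_of_hasCompactSupport φ.continuous hφs
      simpa using this
    have e : (∫ z, g (splitQC d z) * Φ z) - ∫ ξ, g ξ * F ξ =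
        (∫ z, (g (splitQC d z) - φ (splitQC d z)) * Φ z) - ∫ ξ, (g ξ - φ ξ) * F ξ := by
      simp only [sub_mul]
      rw [integral_sub i1 i2, integral_sub i3 i4, hφ φ]
      ring
    have b1 : ‖∫ z, (g (splitQC d z) - φ (splitQC d z)) * Φ z‖ ≤ ε * ∫ z, ‖Φ z‖ := by
      rw [← integral_const_mul]
      refine norm_integral_le_of_norm_le (Φ.integrable.norm.const_mul ε) (Eventually.of_forall fun z => ?_)
      rw [norm_mul]
      gcongr
      exact hd1 _
    have b2 : ‖∫ ξ, (g ξ - φ ξ) * F ξ‖ ≤ ε * ∫ ξ in K, ‖F ξ‖ := by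
      rw [← integral_const_mul, ← setIntegral_eq_integral_of_forall_compl_eq_zero (s := K)
        (fun x hx => by rw [hd2 x hx, zero_mul])]
      refine norm_integral_le_of_norm_le (hFK.norm.const_mul ε) (Eventually.of_forall fun z => ?_)
      rw [norm_mul]
      gcongr
      exact hd1 _
    rw [e, mul_add]
    exact (norm_sub_le _ _).trans (add_le_add b1 b2)
  rw [← sub_eq_zero, ← norm_le_zero_iff]
  have hlim : Tendsto (fun ε : ℝ => ε * ((∫ z, ‖Φ z‖) + ∫ ξ in K, ‖F ξ‖)) (nhdsWithin 0 (Set.Ioi 0)) (nhds 0) := by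
    have hc : Continuous (fun ε : ℝ => ε * ((∫ z, ‖Φ z‖) + ∫ ξ in K, ‖F ξ‖)) := by fun_prop
    have := (hc.tendsto 0).mono_left (nhdsWithin_le_nhds (s := Set.Ioi 0))
    simpa only [zero_mul] using this
  refine ge_of_tendsto hlim ?_
  filter_upwards [self_mem_nhdsWithin] with ε hε using key ε hε

lemma gp_unique {f f' : ℂ → ℂ} (hf : ContinuousOn f ({0}ᶜ : Set ℂ)) (hf' : ContinuousOn f' ({0}ᶜ : Set ℂ))
    (h : ∀ g : ℂ → ℂ, Continuous g → HasCompactSupport g → (0 : ℂ) ∉ tsupport g →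
      ∫ ξ, g ξ * f' ξ = ∫ ξ, g ξ * f ξ) : Set.EqOn f' f ({0}ᶜ : Set ℂ) := by
  have hU : IsOpen ({0}ᶜ : Set ℂ) := isOpen_compl_singleton
  have hint : ∀ {u : ℂ → ℂ}, ContinuousOn u ({0}ᶜ : Set ℂ) → ∀ g : ℂ → ℝ, Continuous g → HasCompactSupport g →
      tsupport g ⊆ ({0}ᶜ : Set ℂ) → Integrable (fun ξ => g ξ • u ξ) := by
    intro u hu g hg hgs hgU
    refine Continuous.integrable_of_hasCompactSupport ?_ hgs.smul_right
    rw [continuous_iff_continuousAt]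
    intro x
    by_cases hx : x ∈ tsupport g
    · exact hg.continuousAt.smul (hu.continuousAt (hU.mem_nhds (hgU hx)))
    · have : (fun ξ => g ξ • u ξ) =ᶠ[nhds x] fun _ => 0 := by
        filter_upwards [(isClosed_tsupport g).isOpen_compl.mem_nhds hx] with y hy
        rw [image_eq_zero_of_notMem_tsupport hy, zero_smul]
      exact continuousAt_const.congr this.symm
  have hli : LocallyIntegrableOn (fun ξ => f' ξ - f ξ) ({0}ᶜ : Set ℂ) volume :=
    (hf'.sub hf).locallyIntegrableOn hU.measurableSet
  have hae := hU.ae_eq_zero_of_integral_contDiff_smul_eq_zero hli (fun g hg hgs hgU => by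
    have e := h (fun x => ((g x : ℝ) : ℂ)) (Complex.continuous_ofReal.comp hg.continuous)
      (hgs.comp_left (g := fun r : ℝ => (r : ℂ)) Complex.ofReal_zero) (fun h0 => by
        have : (0 : ℂ) ∈ tsupport g := by
          refine closure_mono ?_ h0
          intro x hx
          simpa using hx
        exact hgU this rfl)
    simp only [smul_sub]
    rw [integral_sub (hint hf' g hg.continuous hgs hgU) (hint hf g hg.continuous hgs hgU), sub_eq_zero]
    simpa only [Complex.real_smul] using e)
  refine Measure.eqOn_open_of_ae_eq (μ := volume) ?_ hU hf' hf
  rw [EventuallyEq, ae_restrict_iff' hU.measurableSet]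
  filter_upwards [hae] with x hx hxU using sub_eq_zero.1 (hx hxU)

end Assembly

/-- germ of the pushforward of a Schwartz measure under the split quadratic
form on `ℂ^d`, `d` even: there is a unique density `f`, smooth (as a function of the two
real coordinates) away from `0`, and at `0` it has the form
`C₀(ξ) + C₁(ξ)·|ξ|^{d−2}·log|ξ|` with `C₀, C₁` smooth. -/
theorem germ_pushforward_complex_even (d : ℕ) (hd : 2 ≤ d) (hde : Even d)
    (Φ : SchwartzMap (Fin d → ℂ) ℂ) :
    ∃ f : ℂ → ℂ,
      (∀ n : ℕ, ContDiffOn ℝ n f ({0}ᶜ : Set ℂ)) ∧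
      (∀ g : ℂ → ℂ, Continuous g → HasCompactSupport g → (0 : ℂ) ∉ tsupport g →
        ∫ z : Fin d → ℂ, g (splitQC d z) * Φ z = ∫ ξ : ℂ, g ξ * f ξ) ∧
      (∀ f' : ℂ → ℂ, (∀ n : ℕ, ContDiffOn ℝ n f' ({0}ᶜ : Set ℂ)) →
        (∀ g : ℂ → ℂ, Continuous g → HasCompactSupport g → (0 : ℂ) ∉ tsupport g →
          ∫ z : Fin d → ℂ, g (splitQC d z) * Φ z = ∫ ξ : ℂ, g ξ * f' ξ) →
        Set.EqOn f' f ({0}ᶜ : Set ℂ)) ∧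
      (∃ C₀ C₁ : ℂ → ℂ,
        (∀ n : ℕ, ContDiff ℝ n C₀) ∧ (∀ n : ℕ, ContDiff ℝ n C₁) ∧
        ∀ ξ : ℂ, ξ ≠ 0 →
          f ξ = C₀ ξ + C₁ ξ * ((‖ξ‖ ^ (d - 2) : ℝ) : ℂ) *
            ((Real.log ‖ξ‖ : ℝ) : ℂ)) := by
  obtain ⟨μ, rfl⟩ : ∃ μ, d = 2 * (μ + 1) := by
    obtain ⟨m, hm⟩ := hde
    exact ⟨m - 1, by omega⟩
  obtain ⟨C₀, C₁, h0, h1, hF, hφ⟩ := gp_germ μ Φ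
  have hsm : ∀ n : ℕ, ContDiffOn ℝ n (gpF μ C₀ C₁) ({0}ᶜ : Set ℂ) := by
    intro n x hx
    have hW : ContDiff ℝ n (fun ξ : ℂ => ((‖ξ‖ ^ (2 * μ) : ℝ) : ℂ)) := by
      have h2 : ContDiff ℝ n (fun ξ : ℂ => ‖ξ‖ ^ (2 * μ)) := by
        simp only [pow_mul]
        exact (contDiff_norm_sq ℝ).pow μ
      exact Complex.ofRealCLM.contDiff.comp h2
    exact ((h0 n).contDiffAt.add (((h1 n).contDiffAt.mul hW.contDiffAt).mul
      (gp_log_contDiffAt hx))).contDiffWithinAt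
  refine ⟨gpF μ C₀ C₁, hsm, fun g hg hgs _ => gp_extend Φ hF hφ hg hgs, fun f' hf' hg' => ?_,
    C₀, C₁, h0, h1, fun ξ _ => ?_⟩
  · exact gp_unique (hsm 0).continuousOn (hf' 0).continuousOn fun g hg hgs hg0 =>
      (hg' g hg hgs hg0).symm.trans (gp_extend Φ hF hφ hg hgs)
  · rw [gpF, show 2 * (μ + 1) - 2 = 2 * μ by omega]
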